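/- arXiv:1105.2694 — 5 statements merged into one kernel-verified Lean document; each statement's English description precedes it below -/
import Mathlib

section
/- Let m ≥ 1 and N ≥ 2 be integers and let p be a real number with 1 < p ≤ N − 1. Suppose a_1,…,a_m : [0,∞) → [0,∞) are continuous and f_1,…,f_m satisfy (C1)–(C3). Then there exists β > 0 and a radial solution (u_1,…,u_m) of the system with coefficients a_1,…,a_m and initial value β; in particular each u_i is continuous, nondecreasing and satisfies u_i(r) ≥ β > 0 for all r ≥ 0, so the system has a nonnegative nontrivial entire radial solution. -/
open Real MeasureTheory Filter Set intervalIntegral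

/-- `F(s) = ∫_0^s Σ_{i=1}^m f_i(t,…,t) dt`. -/
noncomputable def Fsum (m : ℕ) (f : Fin m → (Fin m → ℝ) → ℝ) (s : ℝ) : ℝ :=
  ∫ t in (0:ℝ)..s, ∑ i, f i (fun _ => t)

/-- Conditions (C1)–(C2): each `f j` maps `[0,∞)^m` to `[0,∞)`, is continuously
differentiable in each variable, vanishes at the origin, is positive when all
arguments are positive, and is nondecreasing in each variable. -/
def SatC12 (m : ℕ) (f : Fin m → (Fin m → ℝ) → ℝ) : Prop :=
  (∀ j (i : Fin m) (s : Fin m → ℝ), (∀ l, 0 ≤ s l) →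
    ContDiffOn ℝ 1 (fun t => f j (Function.update s i t)) (Set.Ici 0)) ∧
  (∀ j s, (∀ l, 0 ≤ s l) → 0 ≤ f j s) ∧
  (∀ j, f j (fun _ => 0) = 0) ∧
  (∀ j s, (∀ l, 0 < s l) → 0 < f j s) ∧
  (∀ j s t, (∀ l, 0 ≤ s l) → (∀ l, s l ≤ t l) → f j s ≤ f j t)

/-- Condition (C3): `∫_1^∞ F(s)^(-1/p) ds = ∞`. -/
def SatC3 (m : ℕ) (p : ℝ) (f : Fin m → (Fin m → ℝ) → ℝ) : Prop :=
  Tendsto (fun r => ∫ s in (1:ℝ)..r, (Fsum m f s) ^ (-1/p)) atTop atTop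

/-- A radial solution of the system with coefficients `b` and initial value `β`:
`w i r = β + ∫_0^r (t^(1-N) ∫_0^t s^(N-1) b i s · f i (w₁(s),…,w_m(s)) ds)^(1/(p-1)) dt`. -/
def IsRadialSolution (m N : ℕ) (p : ℝ) (b : Fin m → ℝ → ℝ)
    (f : Fin m → (Fin m → ℝ) → ℝ) (β : ℝ) (w : Fin m → ℝ → ℝ) : Prop :=
  (∀ i, ContinuousOn (w i) (Set.Ici 0)) ∧
  (∀ i r, 0 ≤ r → 0 ≤ w i r) ∧
  (∀ i r, 0 ≤ r → w i r = β + ∫ t in (0:ℝ)..r,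
      (t ^ (1 - (N:ℝ)) * ∫ s in (0:ℝ)..t,
        s ^ ((N:ℝ) - 1) * b i s * f i (fun j => w j s)) ^ (1/(p-1)))

lemma cont_of_sep {m : ℕ} (g : (Fin m → ℝ) → ℝ) (mono : Monotone g)
    (sep : ∀ x i, Continuous fun t => g (Function.update x i t)) : Continuous g := by
  have up : ∀ (x : Fin m → ℝ) (c : ℝ), g x < c → ∀ S : Finset (Fin m),
      ∃ y, x ≤ y ∧ (∀ l ∈ S, x l < y l) ∧ g y < c := by
    intro x c hc S
    induction S using Finset.induction_on with
    | empty => exact ⟨x, le_rfl, by simp, hc⟩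
    | insert i S hi ih =>
      obtain ⟨y, hxy, hS, hy⟩ := ih
      have h1 : ∀ᶠ t in nhds (y i), g (Function.update y i t) < c := by
        apply (sep y i).continuousAt.eventually_lt continuousAt_const
        simpa using hy
      have h2 : ∀ᶠ t in nhdsWithin (y i) (Ioi (y i)), g (Function.update y i t) < c ∧ y i < t :=
        (h1.filter_mono nhdsWithin_le_nhds).and self_mem_nhdsWithin
      obtain ⟨t, ht1, ht2⟩ := h2.exists
      have hle : y ≤ Function.update y i t := by
        intro l
        by_cases h : l = i
        · subst h; simpa using ht2.le
        · simp [Function.update_of_ne h]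
      refine ⟨_, hxy.trans hle, ?_, ht1⟩
      intro l hl
      rcases Finset.mem_insert.1 hl with rfl | hl
      · simpa using (hxy l).trans_lt ht2
      · exact (hS l hl).trans_le (hle l)
  have down : ∀ (x : Fin m → ℝ) (c : ℝ), c < g x → ∀ S : Finset (Fin m),
      ∃ y, y ≤ x ∧ (∀ l ∈ S, y l < x l) ∧ c < g y := by
    intro x c hc S
    induction S using Finset.induction_on with
    | empty => exact ⟨x, le_rfl, by simp, hc⟩
    | insert i S hi ih =>
      obtain ⟨y, hxy, hS, hy⟩ := ih
      have h1 : ∀ᶠ t in nhds (y i), c < g (Function.update y i t) := by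
        apply continuousAt_const.eventually_lt (sep y i).continuousAt
        simpa using hy
      have h2 : ∀ᶠ t in nhdsWithin (y i) (Iio (y i)), c < g (Function.update y i t) ∧ t < y i :=
        (h1.filter_mono nhdsWithin_le_nhds).and self_mem_nhdsWithin
      obtain ⟨t, ht1, ht2⟩ := h2.exists
      have hle : Function.update y i t ≤ y := by
        intro l
        by_cases h : l = i
        · subst h; simpa using ht2.le
        · simp [Function.update_of_ne h]
      refine ⟨_, hle.trans hxy, ?_, ht1⟩
      intro l hl
      rcases Finset.mem_insert.1 hl with rfl | hl
      · simpa using ht2.trans_le (hxy l)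
      · exact (hle l).trans_lt (hS l hl)
  rw [continuous_iff_continuousAt]
  intro x
  rw [ContinuousAt, tendsto_order]
  constructor
  · intro c hc
    obtain ⟨y, _, h2, h3⟩ := down x c hc Finset.univ
    have : ∀ᶠ z in nhds x, ∀ l, y l < z l := by
      rw [eventually_all]
      intro l
      exact continuousAt_const.eventually_lt (continuous_apply l).continuousAt (h2 l (Finset.mem_univ _))
    filter_upwards [this] with z hz
    exact h3.trans_le (mono fun l => (hz l).le)
  · intro c hc
    obtain ⟨y, _, h2, h3⟩ := up x c hc Finset.univ
    have : ∀ᶠ z in nhds x, ∀ l, z l < y l := by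
      rw [eventually_all]
      intro l
      exact (continuous_apply l).continuousAt.eventually_lt continuousAt_const (h2 l (Finset.mem_univ _))
    filter_upwards [this] with z hz
    exact (mono fun l => (hz l).le).trans_lt h3

lemma super_exists (g : ℝ → ℝ) (hg : Continuous g) (g0 : ∀ t, 0 ≤ g t) (gp : ∀ t, 0 < t → 0 < g t)
    (p : ℝ) (hp : 1 < p)
    (hC : Tendsto (fun r => ∫ s in (1:ℝ)..r, (∫ t in (0:ℝ)..s, g t) ^ (-1/p)) atTop atTop)
    (A : ℝ) (hA : 0 < A) :
    ∃ W : ℝ → ℝ, Continuous W ∧ (∀ r, 0 ≤ r → 1 ≤ W r) ∧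
      ∀ r, 0 ≤ r → 1 + ∫ t in (0:ℝ)..r, (∫ s in (0:ℝ)..t, A * g (W s)) ^ (1/(p-1)) ≤ W r := by
  have hp0 : 0 < p := by linarith
  set F : ℝ → ℝ := fun s => ∫ t in (0:ℝ)..s, g t with hF
  have hFd : ∀ s, HasDerivAt F (g s) s := fun s =>
    integral_hasDerivAt_right (hg.intervalIntegrable _ _)
      hg.stronglyMeasurable.stronglyMeasurableAtFilter hg.continuousAt
  have hFc : Continuous F := continuous_iff_continuousAt.2 fun s => (hFd s).continuousAt
  have hFp : ∀ s, 0 < s → 0 < F s := by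
    intro s hs
    apply intervalIntegral_pos_of_pos_on (hg.intervalIntegrable _ _) _ hs
    intro x hx
    exact gp x hx.1
  set φ : ℝ → ℝ := fun s => F (max s 1) ^ (-1/p) with hφ
  have hmp : ∀ s : ℝ, 0 < F (max s 1) := fun s => hFp _ (lt_max_of_lt_right one_pos)
  have φc : Continuous φ := by
    apply Continuous.rpow_const (hFc.comp (continuous_id.max continuous_const))
    intro x; left; exact (hmp x).ne'
  have φp : ∀ s, 0 < φ s := fun s => rpow_pos_of_pos (hmp s) _
  set H : ℝ → ℝ := fun x => ∫ s in (1:ℝ)..x, φ s with hH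
  have Hd : ∀ s, HasDerivAt H (φ s) s := fun s =>
    integral_hasDerivAt_right (φc.intervalIntegrable _ _)
      φc.stronglyMeasurable.stronglyMeasurableAtFilter φc.continuousAt
  have Hc : Continuous H := continuous_iff_continuousAt.2 fun s => (Hd s).continuousAt
  have Hm : StrictMono H := by
    apply strictMono_of_deriv_pos
    intro x
    rw [(Hd x).deriv]; exact φp x
  have Htop : Tendsto H atTop atTop := by
    apply hC.congr'
    filter_upwards [eventually_ge_atTop 1] with r hr
    apply integral_congr
    intro s hs
    rw [uIcc_of_le hr] at hs
    simp only [hφ, max_eq_left hs.1]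
    rfl
  have Hbot : Tendsto H atBot atBot := by
    have : Tendsto (fun x : ℝ => (x - 1) * φ 1) atBot atBot := by
      apply Tendsto.atBot_mul_const (φp 1)
      exact tendsto_atBot_add_const_right _ _ tendsto_id
    apply this.congr'
    filter_upwards [eventually_le_atBot 1] with r hr
    have : H r = ∫ s in (1:ℝ)..r, φ 1 := by
      apply integral_congr
      intro s hs
      rw [uIcc_of_ge hr] at hs
      simp only [hφ, max_eq_right hs.2, max_self]
    rw [this]; simp
  have Hs : Function.Surjective H := Hc.surjective Htop Hbot
  set E := Hm.orderIsoOfSurjective H Hs with hE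
  have HE : ∀ y, H (E.symm y) = y := fun y => E.apply_symm_apply y
  have H1 : H 1 = 0 := by simp [hH]
  have E0 : E.symm 0 = 1 := by
    rw [OrderIso.symm_apply_eq]; exact H1.symm
  have Ed : ∀ y, HasDerivAt E.symm (φ (E.symm y))⁻¹ y := by
    intro y
    apply HasDerivAt.of_local_left_inverse E.symm.continuous.continuousAt (Hd _) (φp _).ne'
    exact Eventually.of_forall HE
  set C : ℝ := (A * p / (p-1)) ^ (1/p) with hCdef
  have hAp : 0 < A * p / (p-1) := by
    apply div_pos (by positivity); linarith
  have C0 : 0 < C := rpow_pos_of_pos hAp _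
  have Cp : C ^ p = A * p / (p-1) := by
    rw [hCdef, ← rpow_mul hAp.le, one_div_mul_cancel hp0.ne', rpow_one]
  set W : ℝ → ℝ := fun r => E.symm (C * r) with hW
  have Wc : Continuous W := E.symm.continuous.comp (continuous_const.mul continuous_id)
  have W1 : ∀ r, 0 ≤ r → 1 ≤ W r := by
    intro r hr
    rw [← E0]
    exact E.symm.monotone (by positivity)
  have Wd : ∀ r, 0 ≤ r → HasDerivAt W (C * F (W r) ^ (1/p)) r := by
    intro r hr
    have h1 : HasDerivAt (fun r => C * r) C r := by
      simpa using (hasDerivAt_id r).const_mul C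
    have h2 := (Ed (C * r)).comp r h1
    suffices e : C * F (W r) ^ (1/p) = (φ (E.symm (C * r)))⁻¹ * C by
      rw [e]; exact h2
    change _ = (F (max (W r) 1) ^ (-1/p))⁻¹ * C
    rw [max_eq_left (W1 r hr), ← rpow_neg (hFp _ (by linarith [W1 r hr])).le, mul_comm]
    congr 2
    ring
  have FWp : ∀ r, 0 ≤ r → 0 < F (W r) := fun r hr => hFp _ (by linarith [W1 r hr])
  refine ⟨W, Wc, W1, ?_⟩
  set Q : ℝ → ℝ := fun r => C ^ (p-1) * F (W r) ^ ((p-1)/p) with hQ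
  have Qd : ∀ r, 0 ≤ r → HasDerivAt Q (A * g (W r)) r := by
    intro r hr
    have h1 : HasDerivAt (fun r => F (W r)) (g (W r) * (C * F (W r) ^ (1/p))) r :=
      (hFd (W r)).comp r (Wd r hr)
    have h2 := (h1.rpow_const (p := (p-1)/p) (Or.inl (FWp r hr).ne')).const_mul (C ^ (p-1))
    have e1 : F (W r) ^ (1/p) * F (W r) ^ ((p-1)/p - 1) = 1 := by
      rw [← rpow_add (FWp r hr)]
      have : 1/p + ((p-1)/p - 1) = 0 := by field_simp; ring
      rw [this, rpow_zero]
    have e2 : C ^ (p-1) * C = A * p / (p-1) := by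
      rw [← Cp, ← rpow_add_one C0.ne']; congr 1; ring
    have hp1 : p - 1 ≠ 0 := by linarith
    have e : A * g (W r) = C ^ (p - 1) * (g (W r) * (C * F (W r) ^ (1 / p)) *
        ((p - 1) / p) * F (W r) ^ ((p - 1) / p - 1)) := by
      calc A * g (W r) = (A * p / (p-1)) * ((p-1)/p) * g (W r) := by field_simp
        _ = (C ^ (p-1) * C) * ((p-1)/p) * g (W r) *
              (F (W r) ^ (1/p) * F (W r) ^ ((p-1)/p - 1)) := by rw [e1, e2, mul_one]
        _ = _ := by ring
    rw [e]; exact h2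
  have gWc : Continuous fun s => A * g (W s) := continuous_const.mul (hg.comp Wc)
  have Qi : ∀ t, 0 ≤ t → ∫ s in (0:ℝ)..t, A * g (W s) ≤ Q t := by
    intro t ht
    rw [integral_eq_sub_of_hasDerivAt (f := Q) (fun x hx => Qd x (by
      rw [uIcc_of_le ht] at hx; exact hx.1)) (gWc.intervalIntegrable _ _)]
    have : 0 ≤ Q 0 := mul_nonneg (rpow_nonneg C0.le _) (rpow_nonneg (FWp 0 le_rfl).le _)
    linarith
  have hp1 : 0 < p - 1 := by linarith
  intro r hr
  have wc : Continuous fun r => C * F (W r) ^ (1/p) :=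
    continuous_const.mul ((hFc.comp Wc).rpow_const fun x => Or.inr (by positivity))
  have hWi : ∫ t in (0:ℝ)..r, C * F (W t) ^ (1/p) = W r - W 0 :=
    integral_eq_sub_of_hasDerivAt (fun x hx => Wd x (by
      rw [uIcc_of_le hr] at hx; exact hx.1)) (wc.intervalIntegrable _ _)
  have W0 : W 0 = 1 := by simp [hW, E0]
  have pc : Continuous fun t => ∫ s in (0:ℝ)..t, A * g (W s) :=
    continuous_primitive (fun a b => gWc.intervalIntegrable a b) 0
  have : ∫ t in (0:ℝ)..r, (∫ s in (0:ℝ)..t, A * g (W s)) ^ (1/(p-1)) ≤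
      ∫ t in (0:ℝ)..r, C * F (W t) ^ (1/p) := by
    apply integral_mono_on hr _ (wc.intervalIntegrable _ _)
    · intro t ht
      have h0 : 0 ≤ ∫ s in (0:ℝ)..t, A * g (W s) :=
        integral_nonneg ht.1 fun s _ => mul_nonneg hA.le (g0 _)
      refine (rpow_le_rpow h0 (Qi t ht.1) (by positivity)).trans_eq ?_
      have hf := FWp t ht.1
      simp only [hQ]
      rw [mul_rpow (by positivity) (by positivity), ← rpow_mul C0.le, ← rpow_mul hf.le]
      have e1 : (p-1) * (1/(p-1)) = 1 := by field_simp
      have e2 : (p-1)/p * (1/(p-1)) = 1/p := by field_simp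
      rw [e1, e2, rpow_one]
    · exact (pc.rpow_const fun x => Or.inr (by positivity)).intervalIntegrable _ _
  linarith

noncomputable def Kop (N : ℕ) (h : ℝ → ℝ) (t : ℝ) : ℝ :=
  t * ∫ x in (0:ℝ)..1, x ^ ((N:ℝ) - 1) * h (t * x)

lemma pow_cont (N : ℕ) (hN : 2 ≤ N) : Continuous fun x : ℝ => x ^ ((N:ℝ) - 1) := by
  have : (2:ℝ) ≤ N := by exact_mod_cast hN
  exact continuous_id.rpow_const fun x => Or.inr (by linarith)

lemma Kop_int (N : ℕ) (hN : 2 ≤ N) (h : ℝ → ℝ) (hc : Continuous h) (t : ℝ) :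
    Continuous (fun x : ℝ => x ^ ((N:ℝ) - 1) * h (t * x)) :=
  (pow_cont N hN).mul (hc.comp (continuous_const.mul continuous_id))

lemma Kop_cont (N : ℕ) (hN : 2 ≤ N) (h : ℝ → ℝ) (hc : Continuous h) : Continuous (Kop N h) := by
  apply continuous_id.mul
  apply intervalIntegral.continuous_parametric_intervalIntegral_of_continuous'
  have h1 : Continuous fun y : ℝ × ℝ => y.2 ^ ((N:ℝ) - 1) := (pow_cont N hN).comp continuous_snd
  have h2 : Continuous fun y : ℝ × ℝ => h (y.1 * y.2) := hc.comp (by fun_prop)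
  exact h1.mul h2

lemma Kop_mono (N : ℕ) (hN : 2 ≤ N) (h k : ℝ → ℝ) (hc : Continuous h) (kc : Continuous k)
    (t : ℝ) (ht : 0 ≤ t) (hk : ∀ s, 0 ≤ s → s ≤ t → h s ≤ k s) : Kop N h t ≤ Kop N k t := by
  apply mul_le_mul_of_nonneg_left _ ht
  apply integral_mono_on zero_le_one ((Kop_int N hN h hc t).intervalIntegrable _ _)
    ((Kop_int N hN k kc t).intervalIntegrable _ _)
  intro x hx
  apply mul_le_mul_of_nonneg_left _ (rpow_nonneg hx.1 _)
  exact hk _ (mul_nonneg ht hx.1) (mul_le_of_le_one_right ht hx.2)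

lemma Kop_nonneg (N : ℕ) (h : ℝ → ℝ) (t : ℝ) (ht : 0 ≤ t) (hk : ∀ s, 0 ≤ h s) :
    0 ≤ Kop N h t := by
  apply mul_nonneg ht
  apply integral_nonneg zero_le_one
  intro x hx
  exact mul_nonneg (rpow_nonneg hx.1 _) (hk _)

lemma Kop_le (N : ℕ) (hN : 2 ≤ N) (h : ℝ → ℝ) (hc : Continuous h)
    (t : ℝ) (ht : 0 ≤ t) (hk : ∀ s, 0 ≤ h s) : Kop N h t ≤ ∫ s in (0:ℝ)..t, h s := by
  have e : ∫ s in (0:ℝ)..t, h s = t * ∫ x in (0:ℝ)..1, h (t * x) := by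
    have := smul_integral_comp_mul_left (a := 0) (b := 1) h t
    simp
  have hN' : (2:ℝ) ≤ N := by exact_mod_cast hN
  rw [e]
  apply mul_le_mul_of_nonneg_left _ ht
  apply integral_mono_on zero_le_one ((Kop_int N hN h hc t).intervalIntegrable _ _)
    ((hc.comp (continuous_const.mul continuous_id)).intervalIntegrable _ _)
  intro x hx
  exact mul_le_of_le_one_left (hk _) (rpow_le_one hx.1 hx.2 (by linarith))

lemma Kop_eq (N : ℕ) (h : ℝ → ℝ) (t : ℝ) (ht : 0 ≤ t) :
    t ^ (1 - (N:ℝ)) * ∫ s in (0:ℝ)..t, s ^ ((N:ℝ) - 1) * h s = Kop N h t := by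
  rcases ht.eq_or_lt with rfl | ht
  · simp [Kop]
  have := smul_integral_comp_mul_left (a := 0) (b := 1) (fun s => s ^ ((N:ℝ) - 1) * h s) t
  rw [mul_zero, mul_one] at this
  rw [← this, Kop, smul_eq_mul]
  have e : ∫ x in (0:ℝ)..1, (t * x) ^ ((N:ℝ) - 1) * h (t * x) =
      ∫ x in (0:ℝ)..1, t ^ ((N:ℝ) - 1) * (x ^ ((N:ℝ) - 1) * h (t * x)) := by
    apply integral_congr
    intro x hx
    rw [uIcc_of_le zero_le_one] at hx
    simp only
    rw [mul_rpow ht.le hx.1, mul_assoc]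
  rw [e, intervalIntegral.integral_const_mul]
  have e2 : t ^ (1 - (N:ℝ)) * t ^ ((N:ℝ) - 1) = 1 := by
    rw [← rpow_add ht]; simp
  calc _ = (t ^ (1 - (N:ℝ)) * t ^ ((N:ℝ) - 1)) * (t * ∫ x in (0:ℝ)..1, x ^ ((N:ℝ) - 1) * h (t * x)) := by ring
    _ = _ := by rw [e2, one_mul]

noncomputable def uit (m N : ℕ) (q : ℝ) (h : Fin m → ℝ → (Fin m → ℝ) → ℝ) : ℕ → Fin m → ℝ → ℝ
  | 0 => fun _ _ => 1
  | k+1 => fun i r => 1 + ∫ t in (0:ℝ)..r,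
      (Kop N (fun s => h i s (fun j => uit m N q h k j s)) t) ^ q

lemma iter_exists (m N : ℕ) (hN : 2 ≤ N) (q : ℝ) (hq : 0 < q)
    (h : Fin m → ℝ → (Fin m → ℝ) → ℝ)
    (hc : ∀ i, Continuous fun y : ℝ × (Fin m → ℝ) => h i y.1 y.2)
    (h0 : ∀ i s x, 0 ≤ h i s x) (hm : ∀ i s, Monotone (h i s))
    (hW : ∀ R : ℝ, 0 < R → ∃ W : ℝ → ℝ, Continuous W ∧ (∀ r, 0 ≤ r → 1 ≤ W r) ∧
      ∀ r, 0 ≤ r → r ≤ R → ∀ i, 1 + ∫ t in (0:ℝ)..r,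
        (∫ s in (0:ℝ)..t, h i s (fun _ => W s)) ^ q ≤ W r) :
    ∃ U : Fin m → ℝ → ℝ, (∀ i, ContinuousOn (U i) (Ici 0)) ∧ (∀ i, MonotoneOn (U i) (Ici 0)) ∧
      (∀ i r, 0 ≤ r → 1 ≤ U i r) ∧
      (∀ i r, 0 ≤ r → U i r = 1 + ∫ t in (0:ℝ)..r,
        (Kop N (fun s => h i s (fun j => U j s)) t) ^ q) := by
  set u := uit m N q h with hu
  have us : ∀ k i r, u (k+1) i r = 1 + ∫ t in (0:ℝ)..r,
      (Kop N (fun s => h i s (fun j => u k j s)) t) ^ q := fun k i r => rfl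
  have u0 : ∀ i r, u 0 i r = 1 := fun i r => rfl
  -- composition continuity
  have hcomp : ∀ i (v : Fin m → ℝ → ℝ), (∀ j, Continuous (v j)) →
      Continuous fun s => h i s (fun j => v j s) := fun i v hv =>
    (hc i).comp (continuous_id.prodMk (continuous_pi hv))
  have kc : ∀ i (v : Fin m → ℝ → ℝ), (∀ j, Continuous (v j)) →
      Continuous fun t => (Kop N (fun s => h i s (fun j => v j s)) t) ^ q := fun i v hv =>
    (Kop_cont N hN _ (hcomp i v hv)).rpow_const fun _ => Or.inr hq.le
  have uc : ∀ k i, Continuous (u k i) := by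
    intro k
    induction k with
    | zero => intro i; exact continuous_const
    | succ k ih =>
      intro i
      exact continuous_const.add (continuous_primitive (fun a b => (kc i _ ih).intervalIntegrable a b) 0)
  have kn : ∀ i (v : ℝ → Fin m → ℝ) t, 0 ≤ t → 0 ≤ (Kop N (fun s => h i s (v s)) t) := fun i v t ht =>
    Kop_nonneg N _ t ht fun s => h0 _ _ _
  have umono : ∀ k i r, 0 ≤ r → u k i r ≤ u (k+1) i r := by
    intro k
    induction k with
    | zero =>
      intro i r hr
      rw [us, u0]
      have : 0 ≤ ∫ t in (0:ℝ)..r, (Kop N (fun s => h i s (fun j => u 0 j s)) t) ^ q :=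
        integral_nonneg hr fun t ht => rpow_nonneg (kn i _ t ht.1) _
      linarith
    | succ k ih =>
      intro i r hr
      rw [us, us (k+1)]
      gcongr 1 + ?_
      apply integral_mono_on hr ((kc i _ (uc k)).intervalIntegrable _ _)
        ((kc i _ (uc (k+1))).intervalIntegrable _ _)
      intro t ht
      apply rpow_le_rpow (kn i _ t ht.1) _ hq.le
      apply Kop_mono N hN _ _ (hcomp i _ (uc k)) (hcomp i _ (uc (k+1))) t ht.1
      intro s hs _
      exact hm i s fun j => ih j s hs
  have umono' : ∀ i r, 0 ≤ r → Monotone fun k => u k i r := fun i r hr =>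
    monotone_nat_of_le_succ fun k => umono k i r hr
  have u1 : ∀ k i r, 0 ≤ r → 1 ≤ u k i r := fun k i r hr => umono' i r hr (Nat.zero_le k)
  -- local bounds
  have bd : ∀ R : ℝ, 0 < R → ∃ W : ℝ → ℝ, Continuous W ∧
      ∀ k i r, 0 ≤ r → r ≤ R → u k i r ≤ W r := by
    intro R hR
    obtain ⟨W, Wc, W1, hWs⟩ := hW R hR
    refine ⟨W, Wc, ?_⟩
    intro k
    induction k with
    | zero => intro i r hr _; exact W1 r hr
    | succ k ih =>
      intro i r hr hrR
      refine le_trans ?_ (hWs r hr hrR i)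
      rw [us]
      gcongr 1 + ?_
      have Wcc := hcomp i (fun _ => W) (fun _ => Wc)
      have pc : Continuous fun t => ∫ s in (0:ℝ)..t, h i s (fun _ => W s) :=
        continuous_primitive (fun a b => Wcc.intervalIntegrable a b) 0
      apply integral_mono_on hr ((kc i _ (uc k)).intervalIntegrable _ _)
        ((pc.rpow_const fun _ => Or.inr hq.le).intervalIntegrable _ _)
      intro t ht
      apply rpow_le_rpow (kn i _ t ht.1) _ hq.le
      refine (Kop_mono N hN _ _ (hcomp i _ (uc k)) Wcc t ht.1 ?_).trans
        (Kop_le N hN _ Wcc t ht.1 fun s => h0 _ _ _)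
      intro s hs hst
      exact hm i s fun j => ih j s hs (hst.trans (ht.2.trans hrR))
  have bdh : ∀ R : ℝ, 0 < R → ∀ i, ∃ M : ℝ, 0 ≤ M ∧ 
      ∀ k s, 0 ≤ s → s ≤ R → h i s (fun j => u k j s) ≤ M := by
    intro R hR i
    obtain ⟨W, Wc, hWb⟩ := bd R hR
    obtain ⟨M, hM⟩ := (isCompact_Icc (a := (0:ℝ)) (b := R)).exists_bound_of_continuousOn
      (hcomp i (fun _ => W) (fun _ => Wc)).continuousOn
    refine ⟨M, (norm_nonneg _).trans (hM 0 ⟨le_rfl, hR.le⟩), ?_⟩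
    intro k s hs hsR
    refine (hm i s fun j => hWb k j s hs hsR).trans ((le_abs_self _).trans (hM s ⟨hs, hsR⟩))
  have bdK : ∀ R : ℝ, 0 < R → ∀ i, ∃ L : ℝ, 0 ≤ L ∧
      ∀ k t, 0 ≤ t → t ≤ R → (Kop N (fun s => h i s (fun j => u k j s)) t) ^ q ≤ L := by
    intro R hR i
    obtain ⟨M, M0, hM⟩ := bdh R hR i
    refine ⟨(R * M) ^ q, by positivity, ?_⟩
    intro k t ht htR
    apply rpow_le_rpow (kn i _ t ht) _ hq.le
    refine (Kop_le N hN _ (hcomp i _ (uc k)) t ht fun s => h0 _ _ _).trans ?_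
    have : ∫ s in (0:ℝ)..t, h i s (fun j => u k j s) ≤ ∫ s in (0:ℝ)..t, M := by
      apply integral_mono_on ht ((hcomp i _ (uc k)).intervalIntegrable _ _) intervalIntegrable_const
      intro s hs
      exact hM k s hs.1 (hs.2.trans htR)
    refine this.trans ?_
    simp only [intervalIntegral.integral_const, sub_zero, smul_eq_mul]
    gcongr
  -- limit
  have lim : ∀ i r, ∃ l, 0 ≤ r → Tendsto (fun k => u k i r) atTop (nhds l) := by
    intro i r
    by_cases hr : 0 ≤ r
    · obtain ⟨W, Wc, hWb⟩ := bd (r+1) (by linarith)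
      exact ⟨_, fun _ => tendsto_atTop_ciSup (umono' i r hr)
        ⟨W r, by rintro _ ⟨k, rfl⟩; exact hWb k i r hr (by linarith)⟩⟩
    · exact ⟨0, fun h => absurd h hr⟩
  choose U hU using lim
  -- Lipschitz
  have lip : ∀ R : ℝ, 0 < R → ∀ i, ∃ L : ℝ, 0 ≤ L ∧ ∀ k r r', 0 ≤ r → r ≤ r' → r' ≤ R →
      0 ≤ u k i r' - u k i r ∧ u k i r' - u k i r ≤ L * (r' - r) := by
    intro R hR i
    obtain ⟨L, L0, hL⟩ := bdK R hR i
    refine ⟨L, L0, ?_⟩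
    intro k r r' hr hrr hrR
    cases k with
    | zero => simp only [u0, sub_self]; exact ⟨le_rfl, mul_nonneg L0 (by linarith)⟩
    | succ k =>
      have e : u (k+1) i r' - u (k+1) i r = ∫ t in r..r',
          (Kop N (fun s => h i s (fun j => u k j s)) t) ^ q := by
        rw [us, us, add_sub_add_left_eq_sub]
        exact integral_interval_sub_left ((kc i _ (uc k)).intervalIntegrable _ _)
          ((kc i _ (uc k)).intervalIntegrable _ _)
      rw [e]
      constructor
      · exact integral_nonneg hrr fun t ht => rpow_nonneg (kn i _ t (hr.trans ht.1)) _
      · have : ∫ t in r..r', (Kop N (fun s => h i s (fun j => u k j s)) t) ^ q ≤ ∫ t in r..r', L := by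
          apply integral_mono_on hrr ((kc i _ (uc k)).intervalIntegrable _ _) intervalIntegrable_const
          intro t ht
          exact hL k t (hr.trans ht.1) (ht.2.trans hrR)
        refine this.trans_eq ?_
        simp [mul_comm]
  have lipU : ∀ R : ℝ, 0 < R → ∀ i, ∃ L : ℝ, 0 ≤ L ∧ ∀ r r', 0 ≤ r → r ≤ r' → r' ≤ R →
      0 ≤ U i r' - U i r ∧ U i r' - U i r ≤ L * (r' - r) := by
    intro R hR i
    obtain ⟨L, L0, hL⟩ := lip R hR i
    refine ⟨L, L0, ?_⟩
    intro r r' hr hrr hrR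
    have ht := (hU i r' (hr.trans hrr)).sub (hU i r hr)
    exact ⟨ge_of_tendsto' ht fun k => (hL k r r' hr hrr hrR).1,
      le_of_tendsto' ht fun k => (hL k r r' hr hrr hrR).2⟩
  refine ⟨U, ?_, ?_, ?_, ?_⟩
  · intro i x hx
    have hx0 : (0:ℝ) ≤ x := hx
    obtain ⟨L, L0, hL⟩ := lipU (x+1) (by linarith) i
    have key : ∀ᶠ y in nhdsWithin x (Ici 0), |U i y - U i x| ≤ L * |y - x| := by
      have h1 : ∀ᶠ y in nhdsWithin x (Ici 0), y < x + 1 :=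
        nhdsWithin_le_nhds (eventually_lt_nhds (by linarith))
      filter_upwards [h1, self_mem_nhdsWithin] with y hy hy0
      have hy0 : (0:ℝ) ≤ y := hy0
      rcases le_total x y with hxy | hxy
      · obtain ⟨a, b⟩ := hL x y hx0 hxy hy.le
        rw [abs_of_nonneg a, abs_of_nonneg (by linarith)]; exact b
      · obtain ⟨a, b⟩ := hL y x hy0 hxy (by linarith)
        rw [abs_sub_comm, abs_sub_comm y, abs_of_nonneg a, abs_of_nonneg (by linarith)]; exact b
    rw [ContinuousWithinAt, tendsto_iff_norm_sub_tendsto_zero]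
    have hz : Tendsto (fun y => L * |y - x|) (nhdsWithin x (Ici 0)) (nhds 0) := by
      have : Continuous fun y => L * |y - x| := by fun_prop
      have := (this.tendsto x).mono_left (nhdsWithin_le_nhds (s := Ici 0))
      simpa using this
    exact squeeze_zero' (Eventually.of_forall fun y => norm_nonneg _) key hz
  · intro i r hr r' hr' hrr
    have hr0 : (0:ℝ) ≤ r := hr
    obtain ⟨L, L0, hL⟩ := lipU (r'+1) (by linarith) i
    linarith [(hL r r' hr0 hrr (by linarith)).1]
  · intro i r hr
    exact ge_of_tendsto' (hU i r hr) fun k => u1 k i r hr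
  · intro i r hr
    obtain ⟨M, M0, hM⟩ := bdh (r+1) (by linarith) i
    obtain ⟨L, L0, hL⟩ := bdK (r+1) (by linarith) i
    have hKlim : ∀ t, 0 ≤ t → t ≤ r → Tendsto
        (fun k => Kop N (fun s => h i s (fun j => u k j s)) t) atTop
        (nhds (Kop N (fun s => h i s (fun j => U j s)) t)) := by
      intro t ht htr
      apply Tendsto.const_mul
      apply intervalIntegral.tendsto_integral_filter_of_dominated_convergence (fun _ => M)
      · exact Eventually.of_forall fun k =>
          (Kop_int N hN _ (hcomp i _ (uc k)) t).aestronglyMeasurable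
      · refine Eventually.of_forall fun k => Eventually.of_forall fun x hx => ?_
        rw [uIoc_of_le zero_le_one] at hx
        have hx0 := hx.1.le
        have hN' : (2:ℝ) ≤ N := by exact_mod_cast hN
        rw [Real.norm_eq_abs, abs_of_nonneg (mul_nonneg (rpow_nonneg hx0 _) (h0 _ _ _))]
        refine (mul_le_of_le_one_left (h0 _ _ _) (rpow_le_one hx0 hx.2 (by linarith))).trans ?_
        have := mul_le_of_le_one_right ht hx.2
        exact hM k _ (mul_nonneg ht hx0) (by linarith)
      · exact intervalIntegrable_const
      · refine Eventually.of_forall fun x hx => ?_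
        rw [uIoc_of_le zero_le_one] at hx
        apply Tendsto.const_mul
        have hcx : Continuous (h i (t * x)) := (hc i).comp (continuous_const.prodMk continuous_id)
        exact (hcx.tendsto _).comp
          (tendsto_pi_nhds.2 fun j => hU j (t*x) (mul_nonneg ht hx.1.le))
    have hlim : Tendsto (fun k => u (k+1) i r) atTop (nhds (1 + ∫ t in (0:ℝ)..r,
        (Kop N (fun s => h i s (fun j => U j s)) t) ^ q)) := by
      apply Tendsto.const_add
      apply intervalIntegral.tendsto_integral_filter_of_dominated_convergence (fun _ => L)
      · exact Eventually.of_forall fun k => (kc i _ (uc k)).aestronglyMeasurable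
      · refine Eventually.of_forall fun k => Eventually.of_forall fun t ht => ?_
        rw [uIoc_of_le hr] at ht
        rw [Real.norm_eq_abs, abs_of_nonneg (rpow_nonneg (kn i _ t ht.1.le) _)]
        exact hL k t ht.1.le (by linarith [ht.2])
      · exact intervalIntegrable_const
      · refine Eventually.of_forall fun t ht => ?_
        rw [uIoc_of_le hr] at ht
        exact (hKlim t ht.1.le ht.2).rpow_const (Or.inr hq.le)
    exact tendsto_nhds_unique ((tendsto_add_atTop_iff_nat 1).2 (hU i r hr)) hlim

/-- Existence of a nonnegative nontrivial entire radial solution for continuous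
spherically symmetric coefficients. -/
theorem stmt2 (m N : ℕ) (p : ℝ) (hm : 1 ≤ m) (hN : 2 ≤ N)
    (hp1 : 1 < p) (hpN : p ≤ (N:ℝ) - 1)
    (a : Fin m → ℝ → ℝ) (hac : ∀ j, ContinuousOn (a j) (Set.Ici 0))
    (hann : ∀ j r, 0 ≤ r → 0 ≤ a j r)
    (f : Fin m → (Fin m → ℝ) → ℝ) (hf12 : SatC12 m f) (hf3 : SatC3 m p f) :
    ∃ β : ℝ, 0 < β ∧ ∃ u : Fin m → ℝ → ℝ,
      IsRadialSolution m N p a f β u ∧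
      (∀ i, MonotoneOn (u i) (Set.Ici 0)) ∧
      (∀ i r, 0 ≤ r → β ≤ u i r) := by
  obtain ⟨f1, f2, f3, f4, f5⟩ := hf12
  set ft : Fin m → (Fin m → ℝ) → ℝ := fun i x => f i (fun l => max (x l) 0) with hft
  set at' : Fin m → ℝ → ℝ := fun i s => a i (max s 0) with hat
  have ft0 : ∀ i x, 0 ≤ ft i x := fun i x => f2 i _ fun l => le_max_right _ _
  have ftm : ∀ i, Monotone (ft i) := fun i x y hxy =>
    f5 i _ _ (fun l => le_max_right _ _) fun l => max_le_max (hxy l) le_rfl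
  have ftc : ∀ i, Continuous (ft i) := by
    intro i
    apply cont_of_sep _ (ftm i)
    intro x j
    have h1 := (f1 i j (fun l => max (x l) 0) fun l => le_max_right _ _).continuousOn
    have h2 : Continuous fun t : ℝ => max t 0 := continuous_id.max continuous_const
    have h3 := h1.comp_continuous h2 fun t => le_max_right t 0
    convert h3 using 1
    funext t
    simp only [hft, Function.comp]
    congr 1
    funext l
    by_cases hl : l = j
    · subst hl; simp
    · simp [Function.update_of_ne hl]
  have atc : ∀ i, Continuous (at' i) := fun i =>
    (hac i).comp_continuous (continuous_id.max continuous_const) fun t => le_max_right t 0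
  have at0 : ∀ i s, 0 ≤ at' i s := fun i s => hann i _ (le_max_right _ _)
  set g : ℝ → ℝ := fun t => ∑ i, ft i (fun _ => t) with hg
  have gc : Continuous g := continuous_finsetSum _ fun i _ =>
    (ftc i).comp (continuous_pi fun _ => continuous_id)
  have g0 : ∀ t, 0 ≤ g t := fun t => Finset.sum_nonneg fun i _ => ft0 i _
  have gp : ∀ t, 0 < t → 0 < g t := by
    intro t ht
    apply Finset.sum_pos
    · intro i _
      exact f4 i _ fun l => lt_max_of_lt_left ht
    · exact ⟨⟨0, hm⟩, Finset.mem_univ _⟩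
  have gC : Tendsto (fun r => ∫ s in (1:ℝ)..r, (∫ t in (0:ℝ)..s, g t) ^ (-1/p)) atTop atTop := by
    apply Tendsto.congr' _ hf3
    filter_upwards [eventually_ge_atTop 1] with r hr
    apply integral_congr
    intro s hs
    rw [uIcc_of_le hr] at hs
    have hs0 : (0:ℝ) ≤ s := zero_le_one.trans hs.1
    simp only [Fsum]
    congr 1
    apply integral_congr
    intro t ht
    rw [uIcc_of_le hs0] at ht
    simp only [hg, hft, max_eq_left ht.1]
  have hq : 0 < 1/(p-1) := by
    apply one_div_pos.2; linarith
  obtain ⟨U, Uc, Um, U1, Ue⟩ := iter_exists m N hN (1/(p-1)) hq (fun i s x => at' i s * ft i x)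
    (fun i => ((atc i).comp continuous_fst).mul ((ftc i).comp continuous_snd))
    (fun i s x => mul_nonneg (at0 i s) (ft0 i x))
    (fun i s x y hxy => mul_le_mul_of_nonneg_left (ftm i hxy) (at0 i s)) (by
      intro R hR
      have hb : ∀ i, ∃ M, ∀ s ∈ Icc (0:ℝ) R, ‖at' i s‖ ≤ M := fun i =>
        (isCompact_Icc (a := (0:ℝ)) (b := R)).exists_bound_of_continuousOn (atc i).continuousOn
      choose M hM using hb
      have M0 : ∀ i, 0 ≤ M i := fun i => (norm_nonneg _).trans (hM i 0 ⟨le_rfl, hR.le⟩)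
      set A : ℝ := 1 + ∑ i, M i with hA
      have A0 : 0 < A := by
        have : 0 ≤ ∑ i, M i := Finset.sum_nonneg fun i _ => M0 i
        linarith
      have haA : ∀ i s, 0 ≤ s → s ≤ R → at' i s ≤ A := by
        intro i s hs hsR
        have h1 := (le_abs_self _).trans (hM i s ⟨hs, hsR⟩)
        have h2 : M i ≤ ∑ i, M i := Finset.single_le_sum (fun i _ => M0 i) (Finset.mem_univ i)
        linarith
      obtain ⟨W, Wc, W1, Ws⟩ := super_exists g gc g0 gp p hp1 gC A A0
      refine ⟨W, Wc, W1, ?_⟩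
      intro r hr hrR i
      refine le_trans ?_ (Ws r hr)
      have c1 : Continuous fun s => at' i s * ft i (fun _ => W s) :=
        (atc i).mul ((ftc i).comp (continuous_pi fun _ => Wc))
      have c2 : Continuous fun s => A * g (W s) := continuous_const.mul (gc.comp Wc)
      have d1 : Continuous fun t => ∫ s in (0:ℝ)..t, at' i s * ft i (fun _ => W s) :=
        continuous_primitive (fun a b => c1.intervalIntegrable a b) 0
      have d2 : Continuous fun t => ∫ s in (0:ℝ)..t, A * g (W s) :=
        continuous_primitive (fun a b => c2.intervalIntegrable a b) 0
      gcongr 1 + ?_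
      apply integral_mono_on hr ((d1.rpow_const fun _ => Or.inr hq.le).intervalIntegrable _ _)
        ((d2.rpow_const fun _ => Or.inr hq.le).intervalIntegrable _ _)
      intro t ht
      apply rpow_le_rpow _ _ hq.le
      · exact integral_nonneg ht.1 fun s _ => mul_nonneg (at0 i s) (ft0 i _)
      · apply integral_mono_on ht.1 (c1.intervalIntegrable _ _) (c2.intervalIntegrable _ _)
        intro s hs
        apply mul_le_mul (haA i s hs.1 (hs.2.trans (ht.2.trans hrR))) _ (ft0 i _) A0.le
        exact Finset.single_le_sum (f := fun i => ft i (fun _ => W s))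
          (fun i _ => ft0 i _) (Finset.mem_univ i))
  refine ⟨1, one_pos, U, ⟨Uc, fun i r hr => zero_le_one.trans (U1 i r hr), ?_⟩, Um, U1⟩
  intro i r hr
  rw [Ue i r hr]
  congr 1
  apply integral_congr
  intro t ht
  rw [uIcc_of_le hr] at ht
  simp only
  rw [← Kop_eq N _ t ht.1]
  congr 2
  apply integral_congr
  intro s hs
  rw [uIcc_of_le ht.1] at hs
  simp only [hat, hft, max_eq_left hs.1, mul_assoc]
  congr 4
  funext l
  exact max_eq_left (zero_le_one.trans (U1 l s hs.1))
end

section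
/- Let m ≥ 1 and N ≥ 2 be integers and let p be a real number with 1 < p ≤ N − 1. Suppose a_1,…,a_m : [0,∞) → [0,∞) are continuous, f_1,…,f_m satisfy (C1)–(C2), and for every j = 1,…,m one has ∫_0^∞ ( t^{1−N} ∫_0^t s^{N−1} a_j(s) ds )^{1/(p−1)} dt = ∞. Then every m-tuple of continuous functions u_1,…,u_m : [0,∞) → [0,∞) satisfying u_i(r) = u_i(0) + ∫_0^r ( t^{1−N} ∫_0^t s^{N−1} a_i(s) f_i(u_1(s),…,u_m(s)) ds )^{1/(p−1)} dt for all r ≥ 0 and all i, in which no component u_i is identically zero, is large: lim_{r→∞} u_i(r) = ∞ for every i = 1,…,m. -/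
open Real MeasureTheory Filter Set intervalIntegral

section helpers

lemma aux_up {m : ℕ} (g : (Fin m → ℝ) → ℝ)
    (hc : ∀ (i : Fin m) (s : Fin m → ℝ), (∀ l, 0 ≤ s l) →
      ContinuousOn (fun t => g (Function.update s i t)) (Set.Ici 0))
    (hmono : ∀ s t, (∀ l, 0 ≤ s l) → (∀ l, s l ≤ t l) → g s ≤ g t)
    (y : Fin m → ℝ) (hy : ∀ l, 0 ≤ y l) (S : Finset (Fin m)) :
    ∀ ε > 0, ∃ δ > 0, g (fun l => if l ∈ S then y l + δ else y l) < g y + ε := by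
  classical
  induction S using Finset.induction_on with
  | empty => intro ε hε; exact ⟨1, one_pos, by simpa using hε⟩
  | insert i S hi ih =>
    intro ε hε
    obtain ⟨δ, hδ, h⟩ := ih (ε/2) (by linarith)
    set z : Fin m → ℝ := fun l => if l ∈ S then y l + δ else y l with hz
    have hz0 : ∀ l, 0 ≤ z l := by
      intro l; have := hy l; simp only [hz]; split_ifs <;> linarith
    have hzi : z i = y i := by simp [hz, hi]
    have h1 := hc i z hz0 (y i) (hy i)
    rw [Metric.continuousWithinAt_iff] at h1
    obtain ⟨η, hη, h2⟩ := h1 (ε/2) (by linarith)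
    have h3 := @h2 (y i + η/2) (by have := hy i; simp only [Set.mem_Ici]; linarith)
      (by rw [Real.dist_eq]; simp only [add_sub_cancel_left]; rw [abs_of_pos] <;> linarith)
    have e1 : Function.update z i (y i) = z := by rw [← hzi]; simp
    simp only [e1] at h3
    rw [Real.dist_eq] at h3
    have h4 := (abs_lt.1 h3).2
    refine ⟨min δ (η/2), lt_min hδ (by linarith), ?_⟩
    have h5 : g (fun l => if l ∈ insert i S then y l + min δ (η/2) else y l)
        ≤ g (Function.update z i (y i + η/2)) := by
      apply hmono
      · intro l
        have := hy l
        have : 0 < min δ (η/2) := lt_min hδ (by linarith)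
        split_ifs <;> linarith
      · intro l
        have m1 := min_le_left δ (η/2)
        have m2 := min_le_right δ (η/2)
        by_cases hl : l = i
        · subst hl; simp
        · simp only [Finset.mem_insert, hl, false_or, Function.update_of_ne (Ne.intro hl), hz]
          split_ifs <;> linarith
    linarith

lemma aux_down {m : ℕ} (g : (Fin m → ℝ) → ℝ)
    (hc : ∀ (i : Fin m) (s : Fin m → ℝ), (∀ l, 0 ≤ s l) →
      ContinuousOn (fun t => g (Function.update s i t)) (Set.Ici 0))
    (hmono : ∀ s t, (∀ l, 0 ≤ s l) → (∀ l, s l ≤ t l) → g s ≤ g t)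
    (y : Fin m → ℝ) (hy : ∀ l, 0 ≤ y l) (S : Finset (Fin m)) :
    ∀ ε > 0, ∃ δ > 0, g y - ε < g (fun l => if l ∈ S then max (y l - δ) 0 else y l) := by
  classical
  induction S using Finset.induction_on with
  | empty => intro ε hε; exact ⟨1, one_pos, by simpa using hε⟩
  | insert i S hi ih =>
    intro ε hε
    obtain ⟨δ, hδ, h⟩ := ih (ε/2) (by linarith)
    set z : Fin m → ℝ := fun l => if l ∈ S then max (y l - δ) 0 else y l with hz
    have hz0 : ∀ l, 0 ≤ z l := by
      intro l; have := hy l; simp only [hz]; split_ifs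
      · exact le_max_right _ _
      · exact this
    have hzi : z i = y i := by simp [hz, hi]
    have h1 := hc i z hz0 (y i) (hy i)
    rw [Metric.continuousWithinAt_iff] at h1
    obtain ⟨η, hη, h2⟩ := h1 (ε/2) (by linarith)
    have h3 := @h2 (max (y i - η/2) 0) (Set.mem_Ici.2 (le_max_right _ _))
      (by
        have := hy i
        rw [Real.dist_eq, abs_lt]
        constructor
        · have := le_max_left (y i - η/2) 0; linarith
        · have : max (y i - η/2) 0 ≤ y i := max_le (by linarith) this
          linarith)
    have e1 : Function.update z i (y i) = z := by rw [← hzi]; simp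
    simp only [e1] at h3
    rw [Real.dist_eq] at h3
    have h4 := (abs_lt.1 h3).1
    refine ⟨min δ (η/2), lt_min hδ (by linarith), ?_⟩
    have h5 : g (Function.update z i (max (y i - η/2) 0)) ≤
        g (fun l => if l ∈ insert i S then max (y l - min δ (η/2)) 0 else y l) := by
      apply hmono
      · intro l
        by_cases hl : l = i
        · subst hl; simp
        · rw [Function.update_of_ne hl]; exact hz0 l
      · intro l
        have m1 := min_le_left δ (η/2)
        have m2 := min_le_right δ (η/2)
        by_cases hl : l = i
        · subst hl
          simp only [Function.update_self, Finset.mem_insert, true_or, if_true]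
          exact max_le_max (by linarith) le_rfl
        · simp only [Finset.mem_insert, hl, false_or, Function.update_of_ne (Ne.intro hl), hz]
          split_ifs
          · exact max_le_max (by linarith) le_rfl
          · exact le_rfl
    linarith

lemma aux_cont {m : ℕ} (g : (Fin m → ℝ) → ℝ)
    (hc : ∀ (i : Fin m) (s : Fin m → ℝ), (∀ l, 0 ≤ s l) →
      ContinuousOn (fun t => g (Function.update s i t)) (Set.Ici 0))
    (hmono : ∀ s t, (∀ l, 0 ≤ s l) → (∀ l, s l ≤ t l) → g s ≤ g t) :
    ContinuousOn g {s | ∀ l, 0 ≤ s l} := by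
  intro y hy
  rw [Metric.continuousWithinAt_iff]
  intro ε hε
  obtain ⟨δ, hδ, h1⟩ := aux_up g hc hmono y hy Finset.univ ε hε
  obtain ⟨η, hη, h2⟩ := aux_down g hc hmono y hy Finset.univ ε hε
  simp only [Finset.mem_univ, if_true] at h1 h2
  refine ⟨min δ η, lt_min hδ hη, ?_⟩
  intro x hx hd
  have hl : ∀ l, |x l - y l| < min δ η := by
    intro l
    have := dist_le_pi_dist x y l
    rw [Real.dist_eq] at this
    linarith
  have m1 := min_le_left δ η
  have m2 := min_le_right δ η
  have h3 : g x ≤ g (fun l => y l + δ) := by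
    apply hmono _ _ hx
    intro l
    have := (abs_lt.1 (hl l)).2
    linarith
  have h4 : g (fun l => max (y l - η) 0) ≤ g x := by
    apply hmono
    · intro l; exact le_max_right _ _
    intro l
    have := (abs_lt.1 (hl l)).1
    exact max_le (by linarith) (hx l)
  rw [Real.dist_eq, abs_lt]
  constructor <;> linarith

lemma aux_w (N : ℕ) (hN : 2 ≤ N) (h : ℝ → ℝ) (hc : ContinuousOn h (Set.Ici 0)) :
    ContinuousOn (fun s : ℝ => s ^ ((N:ℝ) - 1) * h s) (Set.Ici 0) := by
  have hN' : (2:ℝ) ≤ N := by exact_mod_cast hN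
  exact (Real.continuous_rpow_const (by linarith)).continuousOn.mul hc

lemma aux_wi (N : ℕ) (hN : 2 ≤ N) (h : ℝ → ℝ) (hc : ContinuousOn h (Set.Ici 0))
    (x y : ℝ) (hx : 0 ≤ x) (hy : 0 ≤ y) :
    IntervalIntegrable (fun s : ℝ => s ^ ((N:ℝ) - 1) * h s) volume x y := by
  apply ContinuousOn.intervalIntegrable
  apply (aux_w N hN h hc).mono
  intro z hz
  exact le_trans (le_min hx hy) hz.1

lemma aux_nonneg (N : ℕ) (h : ℝ → ℝ) (hn : ∀ r, 0 ≤ r → 0 ≤ h r)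
    (x y : ℝ) (hx : 0 ≤ x) (hxy : x ≤ y) :
    0 ≤ ∫ s in x..y, s ^ ((N:ℝ) - 1) * h s := by
  apply intervalIntegral.integral_nonneg hxy
  intro s hs
  have : 0 ≤ s := hx.trans hs.1
  exact mul_nonneg (Real.rpow_nonneg this _) (hn s this)

lemma aux_int (N : ℕ) (hN : 2 ≤ N) (q : ℝ) (hq : 0 < q) (h : ℝ → ℝ)
    (hc : ContinuousOn h (Set.Ici 0)) (hn : ∀ r, 0 ≤ r → 0 ≤ h r) (R : ℝ) (hR : 0 ≤ R) :
    IntervalIntegrable (fun t : ℝ => (t ^ (1 - (N:ℝ)) *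
      ∫ s in (0:ℝ)..t, s ^ ((N:ℝ) - 1) * h s) ^ q) volume 0 R := by
  have hN' : (2:ℝ) ≤ N := by exact_mod_cast hN
  obtain ⟨C, hC⟩ := (isCompact_Icc (a := (0:ℝ)) (b := R)).exists_bound_of_continuousOn
    (hc.mono (fun z hz => hz.1))
  have hC0 : 0 ≤ C := (norm_nonneg _).trans (hC 0 ⟨le_rfl, hR⟩)
  rw [intervalIntegrable_iff_integrableOn_Ioc_of_le hR]
  have hcont : ContinuousOn (fun t : ℝ => (t ^ (1 - (N:ℝ)) *
      ∫ s in (0:ℝ)..t, s ^ ((N:ℝ) - 1) * h s) ^ q) (Set.Ioc 0 R) := by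
    apply ContinuousOn.rpow_const
    · apply ContinuousOn.mul
      · intro t ht
        exact (Real.continuousAt_rpow_const t _ (Or.inl ht.1.ne')).continuousWithinAt
      · have := intervalIntegral.continuousOn_primitive_interval
          (μ := volume) (f := fun s : ℝ => s ^ ((N:ℝ) - 1) * h s) (a := 0) (b := R)
          (by
            rw [Set.uIcc_of_le hR]
            exact ((aux_w N hN h hc).mono (fun z hz => hz.1)).integrableOn_Icc)
        rw [Set.uIcc_of_le hR] at this
        exact this.mono Set.Ioc_subset_Icc_self
    · intro t ht; right; exact hq.le
  apply Integrable.of_bound (C := (C * R) ^ q)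
  · exact hcont.aestronglyMeasurable measurableSet_Ioc
  · rw [ae_restrict_iff' measurableSet_Ioc]
    filter_upwards with t ht
    have hG0 := aux_nonneg N h hn 0 t le_rfl ht.1.le
    have hG : ∫ s in (0:ℝ)..t, s ^ ((N:ℝ) - 1) * h s ≤ ∫ s in (0:ℝ)..t, t ^ ((N:ℝ) - 1) * C := by
      apply intervalIntegral.integral_mono_on ht.1.le (aux_wi N hN h hc 0 t le_rfl ht.1.le)
        (by simp)
      intro s hs
      have := hC s ⟨hs.1, hs.2.trans ht.2⟩
      rw [Real.norm_eq_abs] at this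
      exact mul_le_mul (Real.rpow_le_rpow hs.1 hs.2 (by linarith)) ((le_abs_self _).trans this)
        (hn s hs.1) (Real.rpow_nonneg ht.1.le _)
    rw [intervalIntegral.integral_const, smul_eq_mul, sub_zero] at hG
    have hp0 : 0 ≤ t ^ (1 - (N:ℝ)) := Real.rpow_nonneg ht.1.le _
    rw [Real.norm_eq_abs, abs_of_nonneg (Real.rpow_nonneg (mul_nonneg hp0 hG0) _)]
    apply Real.rpow_le_rpow (mul_nonneg hp0 hG0) _ hq.le
    have e : t ^ (1 - (N:ℝ)) * t ^ ((N:ℝ) - 1) = 1 := by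
      rw [← Real.rpow_add ht.1]; simp
    calc _ ≤ t ^ (1 - (N:ℝ)) * (t * (t ^ ((N:ℝ) - 1) * C)) := mul_le_mul_of_nonneg_left hG hp0
      _ = (t ^ (1 - (N:ℝ)) * t ^ ((N:ℝ) - 1)) * (C * t) := by ring
      _ = C * t := by rw [e, one_mul]
      _ ≤ C * R := mul_le_mul_of_nonneg_left ht.2 hC0

lemma aux_int' (N : ℕ) (hN : 2 ≤ N) (q : ℝ) (hq : 0 < q) (h : ℝ → ℝ)
    (hc : ContinuousOn h (Set.Ici 0)) (hn : ∀ r, 0 ≤ r → 0 ≤ h r) (x y : ℝ) (hx : 0 ≤ x)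
    (hy : 0 ≤ y) :
    IntervalIntegrable (fun t : ℝ => (t ^ (1 - (N:ℝ)) *
      ∫ s in (0:ℝ)..t, s ^ ((N:ℝ) - 1) * h s) ^ q) volume x y :=
  (aux_int N hN q hq h hc hn x hx).symm.trans (aux_int N hN q hq h hc hn y hy)

lemma aux_g_nonneg (N : ℕ) (q : ℝ) (h : ℝ → ℝ) (hn : ∀ r, 0 ≤ r → 0 ≤ h r) (t : ℝ)
    (ht : 0 ≤ t) : 0 ≤ (t ^ (1 - (N:ℝ)) *
      ∫ s in (0:ℝ)..t, s ^ ((N:ℝ) - 1) * h s) ^ q :=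
  Real.rpow_nonneg (mul_nonneg (Real.rpow_nonneg ht _) (aux_nonneg N h hn 0 t le_rfl ht)) _

/-- The primitive of `s^(N-1) a` is not eventually constant. -/
lemma aux_grow (N : ℕ) (hN : 2 ≤ N) (p : ℝ) (hp1 : 1 < p) (hpN : p ≤ (N:ℝ) - 1)
    (h : ℝ → ℝ) (hc : ContinuousOn h (Set.Ici 0)) (hn : ∀ r, 0 ≤ r → 0 ≤ h r)
    (hdiv : Tendsto (fun R => ∫ t in (0:ℝ)..R,
      (t ^ (1 - (N:ℝ)) * ∫ s in (0:ℝ)..t, s ^ ((N:ℝ) - 1) * h s) ^ (1/(p-1))) atTop atTop)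
    (T : ℝ) (hT : 0 < T) : ∃ T1, T ≤ T1 ∧ 0 < ∫ s in T..T1, s ^ ((N:ℝ) - 1) * h s := by
  by_contra hcon
  push Not at hcon
  have hq : 0 < 1/(p-1) := one_div_pos.2 (by linarith)
  set A := ∫ s in (0:ℝ)..T, s ^ ((N:ℝ) - 1) * h s with hA
  have hA0 : 0 ≤ A := aux_nonneg N h hn 0 T le_rfl hT.le
  set e := (1 - (N:ℝ)) * (1/(p-1)) with he
  have he1 : e < -1 := by
    rw [he, mul_one_div, div_lt_iff₀ (by linarith)]; linarith
  set B := ∫ t in (0:ℝ)..T,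
      (t ^ (1 - (N:ℝ)) * ∫ s in (0:ℝ)..t, s ^ ((N:ℝ) - 1) * h s) ^ (1/(p-1)) with hB
  have key : ∀ R, T ≤ R → (∫ t in (0:ℝ)..R,
      (t ^ (1 - (N:ℝ)) * ∫ s in (0:ℝ)..t, s ^ ((N:ℝ) - 1) * h s) ^ (1/(p-1))) ≤
      B + A ^ (1/(p-1)) * (T ^ (e+1) / (-(e+1))) := by
    intro R hR
    have hR0 : 0 < R := hT.trans_le hR
    rw [← intervalIntegral.integral_add_adjacent_intervals
      (aux_int' N hN _ hq h hc hn 0 T le_rfl hT.le) (aux_int' N hN _ hq h hc hn T R hT.le hR0.le)]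
    have : ∫ t in T..R,
      (t ^ (1 - (N:ℝ)) * ∫ s in (0:ℝ)..t, s ^ ((N:ℝ) - 1) * h s) ^ (1/(p-1)) =
      ∫ t in T..R, A ^ (1/(p-1)) * t ^ e := by
      apply intervalIntegral.integral_congr
      intro t ht
      rw [Set.uIcc_of_le hR] at ht
      have ht0 : 0 < t := hT.trans_le ht.1
      have h1 : ∫ s in T..t, s ^ ((N:ℝ) - 1) * h s = 0 :=
        le_antisymm (hcon t ht.1) (aux_nonneg N h hn T t hT.le ht.1)
      have h2 := intervalIntegral.integral_add_adjacent_intervals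
        (aux_wi N hN h hc 0 T le_rfl hT.le) (aux_wi N hN h hc T t hT.le ht0.le)
      rw [h1, add_zero] at h2
      dsimp only
      rw [← h2, ← hA, Real.mul_rpow (Real.rpow_nonneg ht0.le _) hA0, ← Real.rpow_mul ht0.le,
        mul_comm]
    rw [this, intervalIntegral.integral_const_mul, integral_rpow (Or.inr ⟨by linarith, by
      rw [Set.uIcc_of_le hR]; intro hh; linarith [hh.1]⟩)]
    have hle : (R ^ (e + 1) - T ^ (e + 1)) / (e + 1) ≤ T ^ (e+1) / (-(e+1)) := by
      rw [div_neg, ← neg_div, div_le_div_right_of_neg (by linarith)]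
      have := Real.rpow_nonneg hR0.le (e+1)
      linarith
    have := mul_le_mul_of_nonneg_left hle (Real.rpow_nonneg hA0 (1/(p-1)))
    linarith
  obtain ⟨R, hR1, hR2⟩ := ((hdiv.eventually_gt_atTop
    (B + A ^ (1/(p-1)) * (T ^ (e+1) / (-(e+1))))).and (eventually_ge_atTop T)).exists
  exact absurd (key R hR2) (not_le.2 hR1)

end helpers

/-- If `∫_0^∞ (t^(1-N) ∫_0^t s^(N-1) a_j(s) ds)^(1/(p-1)) dt = ∞` for all `j`, then
every nonnegative nontrivial entire radial solution is large. -/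
theorem stmt3 (m N : ℕ) (p : ℝ) (hm : 1 ≤ m) (hN : 2 ≤ N)
    (hp1 : 1 < p) (hpN : p ≤ (N:ℝ) - 1)
    (a : Fin m → ℝ → ℝ) (hac : ∀ j, ContinuousOn (a j) (Set.Ici 0))
    (hann : ∀ j r, 0 ≤ r → 0 ≤ a j r)
    (f : Fin m → (Fin m → ℝ) → ℝ) (hf12 : SatC12 m f)
    (hdiv : ∀ j, Tendsto (fun R => ∫ t in (0:ℝ)..R,
      (t ^ (1 - (N:ℝ)) * ∫ s in (0:ℝ)..t, s ^ ((N:ℝ) - 1) * a j s) ^ (1/(p-1)))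
      atTop atTop)
    (u : Fin m → ℝ → ℝ) (huc : ∀ i, ContinuousOn (u i) (Set.Ici 0))
    (hunn : ∀ i r, 0 ≤ r → 0 ≤ u i r)
    (heq : ∀ i r, 0 ≤ r → u i r = u i 0 + ∫ t in (0:ℝ)..r,
      (t ^ (1 - (N:ℝ)) * ∫ s in (0:ℝ)..t,
        s ^ ((N:ℝ) - 1) * a i s * f i (fun j => u j s)) ^ (1/(p-1)))
    (hnt : ∀ i, ∃ r, 0 ≤ r ∧ u i r ≠ 0) :
    ∀ i, Tendsto (u i) atTop atTop := by
  obtain ⟨hC1, hfn, -, hfpos, hfm⟩ := hf12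
  have hq : 0 < 1/(p-1) := one_div_pos.2 (by linarith)
  set q := 1/(p-1) with hqd
  have hfu : ∀ i, ContinuousOn (fun s => f i (fun j => u j s)) (Set.Ici 0) := by
    intro i
    have h1 := aux_cont (f i) (fun l s hs => (hC1 i l s hs).continuousOn) (hfm i)
    exact h1.comp (continuousOn_pi.2 huc) (fun s hs l => hunn l s hs)
  have hHc : ∀ i, ContinuousOn (fun s => a i s * f i (fun j => u j s)) (Set.Ici 0) :=
    fun i => (hac i).mul (hfu i)
  have hHn : ∀ i r, 0 ≤ r → 0 ≤ a i r * f i (fun j => u j r) :=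
    fun i r hr => mul_nonneg (hann i r hr) (hfn i _ (fun l => hunn l r hr))
  simp only [mul_assoc] at heq
  have hdiff : ∀ i x y, 0 ≤ x → x ≤ y → u i y = u i x + ∫ t in x..y,
      (t ^ (1 - (N:ℝ)) * ∫ s in (0:ℝ)..t,
        s ^ ((N:ℝ) - 1) * (a i s * f i (fun j => u j s))) ^ q := by
    intro i x y hx hxy
    rw [heq i y (hx.trans hxy), heq i x hx, add_assoc,
      intervalIntegral.integral_add_adjacent_intervals
      (aux_int' N hN q hq _ (hHc i) (hHn i) 0 x le_rfl hx)
      (aux_int' N hN q hq _ (hHc i) (hHn i) x y hx (hx.trans hxy))]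
  have hmono : ∀ i x y, 0 ≤ x → x ≤ y → u i x ≤ u i y := by
    intro i x y hx hxy
    rw [hdiff i x y hx hxy]
    have := intervalIntegral.integral_nonneg (μ := volume) hxy
      (fun t ht => aux_g_nonneg N q _ (hHn i) t (hx.trans ht.1))
    linarith
  choose ρ hρ0 hρ using hnt
  obtain ⟨T, hTpos, hT⟩ : ∃ T : ℝ, 0 < T ∧ ∀ i, ρ i ≤ T := by
    refine ⟨1 + ∑ i, ρ i, ?_, ?_⟩
    · have := Finset.sum_nonneg (s := Finset.univ) (fun i _ => hρ0 i)
      linarith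
    · intro i
      have := Finset.single_le_sum (s := Finset.univ) (fun i _ => hρ0 i) (Finset.mem_univ i)
      linarith
  have huT : ∀ i, 0 < u i T := by
    intro i
    have h1 := lt_of_le_of_ne (hunn i _ (hρ0 i)) (hρ i).symm
    exact h1.trans_le (hmono i _ _ (hρ0 i) (hT i))
  intro i
  set k := f i (fun j => u j T) with hk
  have hk0 : 0 < k := hfpos i _ huT
  have hkle : ∀ s, T ≤ s → k ≤ f i (fun j => u j s) := fun s hs =>
    hfm i _ _ (fun l => (huT l).le) (fun l => hmono l T s hTpos.le hs)
  obtain ⟨T1, hT1, hgrow⟩ := aux_grow N hN p hp1 hpN (a i) (hac i) (hann i) (hdiv i) T hTpos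
  have hT10 : 0 < T1 := hTpos.trans_le hT1
  set A : ℝ → ℝ := fun t => ∫ s in (0:ℝ)..t, s ^ ((N:ℝ) - 1) * a i s with hA
  have hAadd : ∀ x y, 0 ≤ x → 0 ≤ y → A y = A x + ∫ s in x..y, s ^ ((N:ℝ) - 1) * a i s := by
    intro x y hx hy
    exact (intervalIntegral.integral_add_adjacent_intervals
      (aux_wi N hN _ (hac i) 0 x le_rfl hx) (aux_wi N hN _ (hac i) x y hx hy)).symm
  have hAT0 : 0 ≤ A T := aux_nonneg N _ (hann i) 0 T le_rfl hTpos.le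
  have hAT1 : A T < A T1 := by rw [hAadd T T1 hTpos.le hT10.le]; linarith
  have hAmono : ∀ t, T1 ≤ t → A T1 ≤ A t := by
    intro t ht
    rw [hAadd T1 t hT10.le (hT10.le.trans ht)]
    have := aux_nonneg N _ (hann i) T1 t hT10.le ht
    linarith
  set θ := (A T1 - A T) / A T1 with hθ
  have hA1pos : 0 < A T1 := hAT0.trans_lt hAT1
  have hθ0 : 0 < θ := div_pos (by linarith) hA1pos
  have hθA : ∀ t, T1 ≤ t → θ * A t ≤ A t - A T := by
    intro t ht
    have h1 := hAmono t ht
    have h2 : θ = 1 - A T / A T1 := by rw [hθ, sub_div, div_self hA1pos.ne']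
    have h3 : A T ≤ A T / A T1 * A t := by
      rw [div_mul_eq_mul_div, le_div_iff₀ hA1pos]
      exact mul_le_mul_of_nonneg_left h1 hAT0
    rw [h2]; linarith
  have hlow : ∀ t, T1 ≤ t → (k * θ) ^ q * (t ^ (1 - (N:ℝ)) * A t) ^ q ≤
      (t ^ (1 - (N:ℝ)) * ∫ s in (0:ℝ)..t,
        s ^ ((N:ℝ) - 1) * (a i s * f i (fun j => u j s))) ^ q := by
    intro t ht
    have ht0 : 0 < t := hT10.trans_le ht
    have hTt : T ≤ t := hT1.trans ht
    have hp0 : 0 ≤ t ^ (1 - (N:ℝ)) := Real.rpow_nonneg ht0.le _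
    have hAt : 0 ≤ A t := hA1pos.le.trans (hAmono t ht)
    have hkθ : 0 ≤ k * θ := (mul_pos hk0 hθ0).le
    rw [← Real.mul_rpow hkθ (mul_nonneg hp0 hAt)]
    apply Real.rpow_le_rpow (mul_nonneg hkθ (mul_nonneg hp0 hAt)) _ hq.le
    have h1 : k * (A t - A T) ≤ ∫ s in (0:ℝ)..t,
        s ^ ((N:ℝ) - 1) * (a i s * f i (fun j => u j s)) := by
      rw [← intervalIntegral.integral_add_adjacent_intervals
        (aux_wi N hN _ (hHc i) 0 T le_rfl hTpos.le) (aux_wi N hN _ (hHc i) T t hTpos.le ht0.le)]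
      have h2 := aux_nonneg N _ (hHn i) 0 T le_rfl hTpos.le
      have h3 : k * (A t - A T) ≤ ∫ s in T..t,
          s ^ ((N:ℝ) - 1) * (a i s * f i (fun j => u j s)) := by
        rw [hAadd T t hTpos.le ht0.le, add_sub_cancel_left,
          ← intervalIntegral.integral_const_mul]
        apply intervalIntegral.integral_mono_on hTt
          ((aux_wi N hN _ (hac i) T t hTpos.le ht0.le).const_mul k)
          (aux_wi N hN _ (hHc i) T t hTpos.le ht0.le)
        intro s hs
        have hs0 : 0 ≤ s := hTpos.le.trans hs.1
        have h4 := mul_le_mul_of_nonneg_left (hkle s hs.1)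
          (mul_nonneg (Real.rpow_nonneg hs0 ((N:ℝ) - 1)) (hann i s hs0))
        linarith
      linarith
    calc k * θ * (t ^ (1 - (N:ℝ)) * A t) = t ^ (1 - (N:ℝ)) * (k * (θ * A t)) := by ring
      _ ≤ t ^ (1 - (N:ℝ)) * (k * (A t - A T)) :=
        mul_le_mul_of_nonneg_left (mul_le_mul_of_nonneg_left (hθA t ht) hk0.le) hp0
      _ ≤ _ := mul_le_mul_of_nonneg_left h1 hp0
  set D : ℝ → ℝ := fun R => ∫ t in (0:ℝ)..R, (t ^ (1 - (N:ℝ)) * A t) ^ q with hD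
  have hDt : Tendsto D atTop atTop := hdiv i
  have hfin : ∀ r, T1 ≤ r → (k * θ) ^ q * (D r - D T1) ≤ u i r := by
    intro r hr
    have hr0 : 0 ≤ r := hT10.le.trans hr
    have e1 : D T1 + ∫ t in T1..r, (t ^ (1 - (N:ℝ)) * A t) ^ q = D r :=
      intervalIntegral.integral_add_adjacent_intervals
        (aux_int' N hN q hq _ (hac i) (hann i) 0 T1 le_rfl hT10.le)
        (aux_int' N hN q hq _ (hac i) (hann i) T1 r hT10.le hr0)
    rw [← e1, add_sub_cancel_left, ← intervalIntegral.integral_const_mul, hdiff i T1 r hT10.le hr]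
    have h0 := hunn i T1 hT10.le
    have h1 : ∫ t in T1..r, (k * θ) ^ q * (t ^ (1 - (N:ℝ)) * A t) ^ q ≤ ∫ t in T1..r,
      (t ^ (1 - (N:ℝ)) * ∫ s in (0:ℝ)..t,
        s ^ ((N:ℝ) - 1) * (a i s * f i (fun j => u j s))) ^ q := by
      apply intervalIntegral.integral_mono_on hr
        ((aux_int' N hN q hq _ (hac i) (hann i) T1 r hT10.le hr0).const_mul _)
        (aux_int' N hN q hq _ (hHc i) (hHn i) T1 r hT10.le hr0)
      intro t ht
      exact hlow t ht.1
    linarith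
  have ht1 : Tendsto (fun r => (k * θ) ^ q * (D r - D T1)) atTop atTop :=
    Tendsto.const_mul_atTop (Real.rpow_pos_of_pos (mul_pos hk0 hθ0) q)
      (tendsto_atTop_add_const_right _ (-D T1) hDt)
  apply tendsto_atTop_mono' atTop _ ht1
  filter_upwards [eventually_ge_atTop T1] with r hr using hfin r hr
end

section
/- Let m ≥ 1 and N ≥ 2 be integers and let p be a real number with 1 < p ≤ N − 1. Suppose f_1,…,f_m satisfy (C1)–(C2), b_1,…,b_m : [0,∞) → [0,∞) are continuous, (w_1,…,w_m) is a radial solution of the system with coefficients b_1,…,b_m and initial value β > 0, and R > 0 is such that r ↦ r^{p(N−1)/(p−1)} Σ_{i=1}^m b_i(r) is nondecreasing on [R,∞). Then each w_i is differentiable on (0,∞) with w_i'(r) = ( r^{1−N} ∫_0^r s^{N−1} b_i(s) f_i(w_1(s),…,w_m(s)) ds )^{1/(p−1)} ≥ 0, and for all r ≥ R one has ( Σ_{i=1}^m w_i'(r) )^p ≤ C r^{p(1−N)/(p−1)} + (p m^{p−1}/(p−1)) ( Σ_{i=1}^m b_i(r) ) F( Σ_{i=1}^m w_i(r) ), where C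 = m^{p−1} R^{p(N−1)/(p−1)} Σ_{i=1}^m ( w_i'(R) )^p and F(s) = ∫_0^s Σ_{i=1}^m f_i(t,…,t) dt. -/
open Real MeasureTheory Filter Set intervalIntegral

/-- The derivative of a radial-solution component:
`w_i'(r) = (r^(1-N) ∫_0^r s^(N-1) b_i(s) f_i(w(s)) ds)^(1/(p-1))`. -/
noncomputable def wderiv (m N : ℕ) (p : ℝ) (b : Fin m → ℝ → ℝ)
    (f : Fin m → (Fin m → ℝ) → ℝ) (w : Fin m → ℝ → ℝ) (i : Fin m) (r : ℝ) : ℝ :=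
  (r ^ (1 - (N:ℝ)) * ∫ s in (0:ℝ)..r,
    s ^ ((N:ℝ) - 1) * b i s * f i (fun j => w j s)) ^ (1/(p-1))


lemma sep_upper {m : ℕ} (g : (Fin m → ℝ) → ℝ) (hmono : Monotone g)
    (hsep : ∀ x i, Continuous (fun t => g (Function.update x i t))) (a : Fin m → ℝ) (c : ℝ)
    (hc : g a < c) : ∀ᶠ x in nhds a, g x < c := by
  have key : ∀ S : Finset (Fin m), ∃ y : Fin m → ℝ,
      (∀ j ∈ S, a j < y j) ∧ (∀ j, j ∉ S → y j = a j) ∧ g y < c := by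
    intro S
    induction S using Finset.induction_on with
    | empty => exact ⟨a, by simp, by simp, hc⟩
    | insert i S hi ih =>
      obtain ⟨y, hy1, hy2, hy3⟩ := ih
      have h0 : g (Function.update y i (a i)) < c := by
        rw [← hy2 i hi, Function.update_eq_self]; exact hy3
      have h1 : ∀ᶠ t in nhds (a i), g (Function.update y i t) < c :=
        (hsep y i).continuousAt.eventually_lt continuousAt_const h0
      have h2 : ∀ᶠ t in nhdsWithin (a i) (Set.Ioi (a i)),
          g (Function.update y i t) < c ∧ a i < t :=
        (h1.filter_mono nhdsWithin_le_nhds).and self_mem_nhdsWithin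
      obtain ⟨t, ht1, ht2⟩ := h2.exists
      refine ⟨Function.update y i t, ?_, ?_, ht1⟩
      · intro j hj
        by_cases hji : j = i
        · subst hji; simpa using ht2
        · rw [Function.update_of_ne hji]
          exact hy1 j (by simpa [hji] using hj)
      · intro j hj
        rw [Finset.mem_insert, not_or] at hj
        rw [Function.update_of_ne hj.1]
        exact hy2 j hj.2
  obtain ⟨y, hy1, -, hy3⟩ := key Finset.univ
  have h : ∀ᶠ x in nhds a, ∀ j, x j < y j := by
    rw [Filter.eventually_all]
    intro j
    exact (continuous_apply j).continuousAt.eventually_lt continuousAt_const (hy1 j (by simp))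
  filter_upwards [h] with x hx
  exact (hmono (fun j => (hx j).le)).trans_lt hy3

lemma sep_cont {m : ℕ} (g : (Fin m → ℝ) → ℝ) (hmono : Monotone g)
    (hsep : ∀ x i, Continuous (fun t => g (Function.update x i t))) : Continuous g := by
  rw [continuous_iff_continuousAt]
  intro a
  refine tendsto_order.2 ⟨?_, fun c hc => sep_upper g hmono hsep a c hc⟩
  intro c hc
  have h := sep_upper (fun x => - g (-x)) (fun x y hxy => neg_le_neg (hmono (neg_le_neg hxy)))
    (fun x i => by
      have : (fun t => - g (-(Function.update x i t)))
          = fun t => - g (Function.update (-x) i (-t)) := by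
        funext t
        congr 2
        funext j
        by_cases hj : j = i
        · subst hj; simp
        · simp [hj]
      rw [this]
      exact ((hsep (-x) i).comp continuous_neg).neg) (-a) (-c) (by simpa using hc)
  have h' := (continuous_neg.tendsto a).eventually h
  filter_upwards [h'] with x hx
  simpa using hx

lemma f_cont {m : ℕ} {f : Fin m → (Fin m → ℝ) → ℝ} (hf : SatC12 m f) (i : Fin m) :
    Continuous (fun x : Fin m → ℝ => f i (fun j => max (x j) 0)) := by
  obtain ⟨h1, -, -, -, h5⟩ := hf
  apply sep_cont
  · intro x y hxy
    exact h5 i _ _ (fun l => le_max_right _ _) (fun l => max_le_max (hxy l) le_rfl)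
  · intro x k
    have hc := (h1 i k (fun j => max (x j) 0) (fun l => le_max_right _ _)).continuousOn
    have := hc.comp_continuous (f := fun t : ℝ => max t 0) (by fun_prop)
      (fun t => Set.mem_Ici.2 (le_max_right t 0))
    convert this using 3 with t
    simp only [Function.comp]
    congr 1
    funext j
    by_cases hj : j = k
    · subst hj; simp
    · simp [hj]

lemma scale_int (N : ℕ) (hN : 2 ≤ N) (h : ℝ → ℝ) (t : ℝ) (ht : 0 ≤ t) :
    t ^ (1 - (N:ℝ)) * ∫ s in (0:ℝ)..t, s ^ ((N:ℝ) - 1) * h s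
      = t * ∫ u in (0:ℝ)..1, u ^ ((N:ℝ) - 1) * h (t * u) := by
  rcases ht.eq_or_lt with rfl | ht
  · simp
  have h1 := intervalIntegral.integral_comp_mul_left (a := 0) (b := 1)
    (fun s => s ^ ((N:ℝ) - 1) * h s) ht.ne'
  have h2 : ∫ u in (0:ℝ)..1, (t * u) ^ ((N:ℝ) - 1) * h (t * u)
      = t ^ ((N:ℝ) - 1) * ∫ u in (0:ℝ)..1, u ^ ((N:ℝ) - 1) * h (t * u) := by
    rw [← intervalIntegral.integral_const_mul]
    apply intervalIntegral.integral_congr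
    intro u hu
    rw [Set.uIcc_of_le zero_le_one] at hu
    simp only
    rw [Real.mul_rpow ht.le hu.1, mul_assoc]
  simp only [mul_zero, mul_one, smul_eq_mul] at h1
  rw [h2] at h1
  have h3 : ∫ s in (0:ℝ)..t, s ^ ((N:ℝ) - 1) * h s
      = t * (t ^ ((N:ℝ) - 1) * ∫ u in (0:ℝ)..1, u ^ ((N:ℝ) - 1) * h (t * u)) := by
    rw [h1]; field_simp
  rw [h3]
  have h4 : t ^ (1 - (N:ℝ)) * t ^ ((N:ℝ) - 1) = 1 := by
    rw [← Real.rpow_add ht]; simp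
  linear_combination (t * ∫ u in (0:ℝ)..1, u ^ ((N:ℝ) - 1) * h (t * u)) * h4

lemma scale_cont (N : ℕ) (hN : 2 ≤ N) (h : ℝ → ℝ) (hh : Continuous h) :
    Continuous (fun t : ℝ => t * ∫ u in (0:ℝ)..1, u ^ ((N:ℝ) - 1) * h (t * u)) := by
  have hN' : (0:ℝ) ≤ (N:ℝ) - 1 := by
    have : (2:ℝ) ≤ N := by exact_mod_cast hN
    linarith
  refine continuous_id.mul ?_
  apply intervalIntegral.continuous_parametric_intervalIntegral_of_continuous'
  have := Real.continuous_rpow_const hN'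
  exact (this.comp continuous_snd).mul (hh.comp (by fun_prop))

/-- Each component of a radial solution is differentiable with the expected nonnegative
derivative, and the gradient estimate
`(Σ w_i'(r))^p ≤ C r^(p(1-N)/(p-1)) + (p m^(p-1)/(p-1)) (Σ b_i(r)) F(Σ w_i(r))` holds for
`r ≥ R`, where `C = m^(p-1) R^(p(N-1)/(p-1)) Σ (w_i'(R))^p`. -/
theorem stmt7 (m N : ℕ) (p : ℝ) (hm : 1 ≤ m) (hN : 2 ≤ N)
    (hp1 : 1 < p) (hpN : p ≤ (N:ℝ) - 1)
    (f : Fin m → (Fin m → ℝ) → ℝ) (hf12 : SatC12 m f)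
    (b : Fin m → ℝ → ℝ) (hbc : ∀ j, ContinuousOn (b j) (Set.Ici 0))
    (hbnn : ∀ j r, 0 ≤ r → 0 ≤ b j r)
    (β : ℝ) (hβ : 0 < β)
    (w : Fin m → ℝ → ℝ) (hw : IsRadialSolution m N p b f β w)
    (R : ℝ) (hR : 0 < R)
    (hmono : ∀ r s, R ≤ r → r ≤ s →
      r ^ (p*((N:ℝ)-1)/(p-1)) * ∑ i, b i r ≤ s ^ (p*((N:ℝ)-1)/(p-1)) * ∑ i, b i s) :
    (∀ i r, 0 < r →
        HasDerivAt (w i) (wderiv m N p b f w i r) r ∧ 0 ≤ wderiv m N p b f w i r) ∧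
    (∀ r, R ≤ r →
      (∑ i, wderiv m N p b f w i r) ^ p ≤
        ((m:ℝ) ^ (p-1) * R ^ (p*((N:ℝ)-1)/(p-1)) * ∑ i, (wderiv m N p b f w i R) ^ p)
            * r ^ (p*(1-(N:ℝ))/(p-1))
          + (p * (m:ℝ) ^ (p-1) / (p-1)) * (∑ i, b i r) * Fsum m f (∑ i, w i r)) := by
  have hN' : (2:ℝ) ≤ N := by exact_mod_cast hN
  have hp0 : 0 < p - 1 := by linarith
  have hq0 : 0 ≤ 1/(p-1) := by positivity
  obtain ⟨hwc, hwnn, hweq⟩ := hw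
  have hf := hf12
  obtain ⟨-, hfnn, -, -, hfm⟩ := hf12
  -- continuous extension of the reaction term
  let h : Fin m → ℝ → ℝ := fun i s => b i (max s 0) * f i (fun j => max (w j (max s 0)) 0)
  have hh : ∀ i s, 0 ≤ s → h i s = b i s * f i (fun j => w j s) := by
    intro i s hs
    simp only [h, max_eq_left hs]
    congr 2
    funext j
    exact max_eq_left (hwnn j s hs)
  have hhc : ∀ i, Continuous (h i) := by
    intro i
    have hb := (hbc i).comp_continuous (f := fun t : ℝ => max t 0) (by fun_prop)
      (fun t => Set.mem_Ici.2 (le_max_right t 0))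
    refine hb.mul ((f_cont hf i).comp (f := fun s j => w j (max s 0)) ?_)
    refine continuous_pi fun j => ?_
    exact (hwc j).comp_continuous (f := fun t : ℝ => max t 0) (by fun_prop)
      (fun t => Set.mem_Ici.2 (le_max_right t 0))
  have hhnn : ∀ i s, 0 ≤ h i s := fun i s =>
    mul_nonneg (hbnn i _ (le_max_right _ _)) (hfnn i _ (fun l => le_max_right _ _))
  let g : Fin m → ℝ → ℝ := fun i s => s ^ ((N:ℝ) - 1) * h i s
  have hgc : ∀ i, Continuous (g i) := fun i =>
    (Real.continuous_rpow_const (by linarith)).mul (hhc i)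
  let G : Fin m → ℝ → ℝ := fun i t => ∫ s in (0:ℝ)..t, g i s
  have hG : ∀ i t, 0 ≤ t →
      ∫ s in (0:ℝ)..t, s ^ ((N:ℝ) - 1) * b i s * f i (fun j => w j s) = G i t := by
    intro i t ht
    apply intervalIntegral.integral_congr
    intro s hs
    rw [Set.uIcc_of_le ht] at hs
    simp only [g]
    rw [hh i s hs.1, mul_assoc]
  have hGnn : ∀ i t, 0 ≤ t → 0 ≤ G i t := by
    intro i t ht
    apply intervalIntegral.integral_nonneg ht
    intro s hs
    exact mul_nonneg (Real.rpow_nonneg hs.1 _) (hhnn i s)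
  have hGd : ∀ i t, HasDerivAt (G i) (g i t) t := fun i t =>
    ((hgc i).integral_hasStrictDerivAt 0 t).hasDerivAt
  let v : Fin m → ℝ → ℝ := fun i r => wderiv m N p b f w i r
  have hv : ∀ i t, 0 ≤ t → v i t = (t ^ (1 - (N:ℝ)) * G i t) ^ (1/(p-1)) := by
    intro i t ht
    simp only [v, wderiv]
    rw [hG i t ht]
  have hvnn : ∀ i t, 0 ≤ t → 0 ≤ v i t := by
    intro i t ht
    rw [hv i t ht]
    exact Real.rpow_nonneg (mul_nonneg (Real.rpow_nonneg ht _) (hGnn i t ht)) _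
  let φ : Fin m → ℝ → ℝ := fun i t =>
    (t * ∫ u in (0:ℝ)..1, u ^ ((N:ℝ) - 1) * h i (t * u)) ^ (1/(p-1))
  have hφc : ∀ i, Continuous (φ i) := fun i =>
    (Real.continuous_rpow_const hq0).comp (scale_cont N hN (h i) (hhc i))
  have hφv : ∀ i t, 0 ≤ t → v i t = φ i t := by
    intro i t ht
    rw [hv i t ht]
    simp only [φ, G, g]
    rw [scale_int N hN (h i) t ht]
  have hwφ : ∀ i r, 0 ≤ r → w i r = β + ∫ t in (0:ℝ)..r, φ i t := by
    intro i r hr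
    rw [hweq i r hr]
    congr 1
    apply intervalIntegral.integral_congr
    intro t ht
    rw [Set.uIcc_of_le hr] at ht
    exact hφv i t ht.1
  have hwd : ∀ i r, 0 < r → HasDerivAt (w i) (v i r) r := by
    intro i r hr
    rw [hφv i r hr.le]
    refine (((hφc i).integral_hasStrictDerivAt 0 r).hasDerivAt.const_add β).congr_of_eventuallyEq ?_
    filter_upwards [lt_mem_nhds hr] with t ht
    exact hwφ i t ht.le
  refine ⟨fun i r hr => ⟨hwd i r hr, hvnn i r hr.le⟩, ?_⟩
  intro r hr
  have hr0 : 0 < r := hR.trans_le hr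
  set κ : ℝ := p*((N:ℝ)-1)/(p-1) with hκ
  have hq1 : 1 ≤ p/(p-1) := by rw [le_div_iff₀ hp0]; linarith
  -- G^q = t^κ v^p
  have hGq : ∀ i t, 0 < t → (G i t) ^ (p/(p-1)) = t ^ κ * (v i t) ^ p := by
    intro i t ht
    have h1 : 0 ≤ t ^ (1 - (N:ℝ)) := Real.rpow_nonneg ht.le _
    rw [hv i t ht.le, ← Real.rpow_mul (mul_nonneg h1 (hGnn i t ht.le)),
      Real.mul_rpow h1 (hGnn i t ht.le), ← Real.rpow_mul ht.le, ← mul_assoc,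
      ← Real.rpow_add ht]
    have e1 : κ + (1 - (N:ℝ)) * (1/(p-1)*p) = 0 := by rw [hκ]; field_simp; ring
    have e2 : 1/(p-1)*p = p/(p-1) := by ring
    rw [e1, e2]; simp
  have hGq' : ∀ i t, 0 < t →
      (G i t) ^ (p/(p-1) - 1) = t ^ (((N:ℝ)-1)/(p-1)) * v i t := by
    intro i t ht
    have h1 : 0 ≤ t ^ (1 - (N:ℝ)) := Real.rpow_nonneg ht.le _
    rw [hv i t ht.le, Real.mul_rpow h1 (hGnn i t ht.le), ← Real.rpow_mul ht.le, ← mul_assoc,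
      ← Real.rpow_add ht]
    have e1 : ((N:ℝ)-1)/(p-1) + (1 - (N:ℝ)) * (1/(p-1)) = 0 := by field_simp; ring
    have e2 : p/(p-1) - 1 = 1/(p-1) := by field_simp; ring
    rw [e1, e2]; simp
  let W : ℝ → ℝ := fun t => ∑ i, w i t
  have hWnn : ∀ t, 0 ≤ t → 0 ≤ W t := fun t ht => Finset.sum_nonneg fun i _ => hwnn i t ht
  have hWd : ∀ t, 0 < t → HasDerivAt W (∑ i, v i t) t := fun t ht =>
    HasDerivAt.fun_sum fun i _ => hwd i t ht
  let fd : ℝ → ℝ := fun t => ∑ i, f i (fun _ => max t 0)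
  have hfdc : Continuous fd := continuous_finsetSum _ fun i _ =>
    (f_cont hf i).comp (f := fun t (_ : Fin m) => t) (by fun_prop)
  have hfdnn : ∀ t, 0 ≤ fd t := fun t =>
    Finset.sum_nonneg fun i _ => hfnn i _ fun _ => le_max_right _ _
  let Fe : ℝ → ℝ := fun s => ∫ t in (0:ℝ)..s, fd t
  have hFe : ∀ s, 0 ≤ s → Fsum m f s = Fe s := by
    intro s hs
    apply intervalIntegral.integral_congr
    intro t ht
    rw [Set.uIcc_of_le hs] at ht
    simp only [fd, max_eq_left ht.1]
  have hFenn : ∀ s, 0 ≤ s → 0 ≤ Fe s := fun s hs =>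
    intervalIntegral.integral_nonneg hs fun t _ => hfdnn t
  have hFed : ∀ s, HasDerivAt Fe (fd s) s := fun s =>
    (hfdc.integral_hasStrictDerivAt 0 s).hasDerivAt
  set q : ℝ := p/(p-1) with hq
  let K : ℝ := r ^ κ * ∑ i, b i r
  let H : ℝ → ℝ := fun t => ∑ i, (G i t) ^ q - q * K * Fe (W t)
  have hHd : ∀ t, 0 < t → HasDerivAt H
      (∑ i, g i t * q * (G i t) ^ (q - 1) - q * K * (fd (W t) * ∑ i, v i t)) t := by
    intro t ht
    refine HasDerivAt.sub (HasDerivAt.fun_sum fun i _ => ?_) ?_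
    · exact (hGd i t).rpow_const (Or.inr hq1)
    · exact ((hFed (W t)).comp t (hWd t ht)).const_mul _
  have hanti : AntitoneOn H (Set.Icc R r) := by
    apply antitoneOn_of_hasDerivWithinAt_nonpos (convex_Icc R r)
      (f' := fun t => ∑ i, g i t * q * (G i t) ^ (q - 1) - q * K * (fd (W t) * ∑ i, v i t))
    · intro t ht
      exact (hHd t (hR.trans_le ht.1)).continuousAt.continuousWithinAt
    · intro t ht
      rw [interior_Icc] at ht
      exact (hHd t (hR.trans ht.1)).hasDerivWithinAt
    · intro t ht
      rw [interior_Icc] at ht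
      have ht0 : 0 < t := hR.trans ht.1
      have hB : t ^ κ * ∑ i, b i t ≤ K := hmono t r ht.1.le ht.2.le
      have hterm : ∀ i, g i t * q * (G i t) ^ (q - 1) ≤ q * K * fd (W t) * v i t := by
        intro i
        rw [hGq' i t ht0]
        have e : t ^ ((N:ℝ)-1) * t ^ (((N:ℝ)-1)/(p-1)) = t ^ κ := by
          rw [← Real.rpow_add ht0]
          congr 1
          rw [hκ]; field_simp; ring
        have e' : g i t * q * (t ^ (((N:ℝ)-1)/(p-1)) * v i t)
            = q * (t ^ κ * b i t) * f i (fun j => w j t) * v i t := by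
          simp only [g]
          rw [hh i t ht0.le, ← e]; ring
        rw [e']
        have h1 : t ^ κ * b i t ≤ K := by
          refine le_trans (mul_le_mul_of_nonneg_left ?_ (Real.rpow_nonneg ht0.le _)) hB
          exact Finset.single_le_sum (f := fun i => b i t) (fun j _ => hbnn j t ht0.le)
            (Finset.mem_univ i)
        have h2 : f i (fun j => w j t) ≤ fd (W t) := by
          have h3 : f i (fun j => w j t) ≤ f i (fun _ => max (W t) 0) := by
            refine hfm i _ _ (fun l => hwnn l t ht0.le) (fun l => ?_)
            refine le_trans ?_ (le_max_left _ _)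
            exact Finset.single_le_sum (f := fun i => w i t) (fun j _ => hwnn j t ht0.le)
              (Finset.mem_univ l)
          refine h3.trans ?_
          exact Finset.single_le_sum (f := fun i => f i (fun _ => max (W t) 0))
            (fun j _ => hfnn j _ fun _ => le_max_right _ _) (Finset.mem_univ i)
        have h4 : 0 ≤ t ^ κ * b i t := mul_nonneg (Real.rpow_nonneg ht0.le _) (hbnn i t ht0.le)
        have h5 : 0 ≤ f i (fun j => w j t) := hfnn i _ fun l => hwnn l t ht0.le
        have h6 : 0 ≤ v i t := hvnn i t ht0.le
        have h7 : 0 ≤ q := by linarith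
        have h8 : 0 ≤ K := h4.trans h1
        gcongr
      have hs := Finset.sum_le_sum fun i (_ : i ∈ Finset.univ) => hterm i
      rw [← Finset.mul_sum] at hs
      linarith
  have hfin : H r ≤ H R := hanti ⟨le_rfl, hr⟩ ⟨hr, le_rfl⟩ hr
  have hKnn : 0 ≤ K := mul_nonneg (Real.rpow_nonneg hr0.le _)
    (Finset.sum_nonneg fun i _ => hbnn i r hr0.le)
  have hqnn : 0 ≤ q := by linarith
  have hFR : 0 ≤ q * K * Fe (W R) := mul_nonneg (mul_nonneg hqnn hKnn) (hFenn _ (hWnn R hR.le))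
  have hmain : r ^ κ * ∑ i, (v i r) ^ p ≤ R ^ κ * ∑ i, (v i R) ^ p + q * K * Fe (W r) := by
    have e1 : ∑ i, (G i r) ^ q = r ^ κ * ∑ i, (v i r) ^ p := by
      rw [Finset.mul_sum]; exact Finset.sum_congr rfl fun i _ => hGq i r hr0
    have e2 : ∑ i, (G i R) ^ q = R ^ κ * ∑ i, (v i R) ^ p := by
      rw [Finset.mul_sum]; exact Finset.sum_congr rfl fun i _ => hGq i R hR
    simp only [H] at hfin
    rw [e1, e2] at hfin
    linarith
  have hpm : (∑ i, v i r) ^ p ≤ (m:ℝ) ^ (p-1) * ∑ i, (v i r) ^ p := by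
    have := Real.rpow_sum_le_const_mul_sum_rpow_of_nonneg (Finset.univ : Finset (Fin m))
      (f := fun i => v i r) hp1.le (fun i _ => hvnn i r hr0.le)
    simpa using this
  have einv : r ^ (p*(1-(N:ℝ))/(p-1)) * r ^ κ = 1 := by
    rw [← Real.rpow_add hr0]
    have : p*(1-(N:ℝ))/(p-1) + κ = 0 := by rw [hκ]; field_simp; ring
    rw [this, Real.rpow_zero]
  set ρ : ℝ := r ^ (p*(1-(N:ℝ))/(p-1)) with hρ
  have hρ0 : 0 ≤ ρ := Real.rpow_nonneg hr0.le _
  have hM0 : 0 ≤ (m:ℝ) ^ (p-1) := Real.rpow_nonneg (Nat.cast_nonneg m) _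
  rw [hFe _ (hWnn r hr0.le)]
  have hmul := mul_le_mul_of_nonneg_left hmain (mul_nonneg hM0 hρ0)
  refine hpm.trans ?_
  have eL : (m:ℝ) ^ (p-1) * ρ * (r ^ κ * ∑ i, (v i r) ^ p)
      = (m:ℝ) ^ (p-1) * ∑ i, (v i r) ^ p := by
    linear_combination ((m:ℝ) ^ (p-1) * ∑ i, (v i r) ^ p) * einv
  rw [eL] at hmul
  refine hmul.trans (le_of_eq ?_)
  have eq : p * (m:ℝ) ^ (p-1) / (p-1) = q * (m:ℝ) ^ (p-1) := by rw [hq]; ring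
  rw [eq]
  simp only [K, v, W]
  linear_combination ((m:ℝ) ^ (p-1) * q * (∑ i, b i r) * Fe (∑ i, w i r)) * einv
end

section
/- Let m ≥ 1 and N ≥ 2 be integers and let p be a real number with 1 < p ≤ N − 1. Suppose f_1,…,f_m satisfy (C1)–(C2), b_1,…,b_m : [0,∞) → [0,∞) are continuous, (w_1,…,w_m) is a radial solution of the system with coefficients b_1,…,b_m and initial value β > 0, R > 0 is such that r ↦ r^{p(N−1)/(p−1)} Σ_{i=1}^m b_i(r) is nondecreasing on [R,∞), and ε > 0. Set F(s) = ∫_0^s Σ_{i=1}^m f_i(t,…,t) dt and C = m^{p−1} R^{p(N−1)/(p−1)} Σ_{i=1}^m ( w_i'(R) )^p. Then for all r ≥ R, ∫_{Σ w_i(R)}^{Σ w_i(r)} F(t)^{−1/p} dt ≤ C^{1/p} F( Σ_{i=1}^m w_i(R) )^{−1/p} · ((p−1)/(N−p)) · R^{(p−N)/(p−1)} + (1/2)^{1/p} ( p m^{p−1}/(p−1) )^{1/p} [ ∫_R^r t^{1+ε} ( Σ_{i=1}^m b_i(t) )^{2/p} dt + 1/(ε R^ε) ], where Σ w_i(·)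 abbreviates Σ_{i=1}^m w_i(·). -/
open Real MeasureTheory Filter Set intervalIntegral

lemma upd_cont {m : ℕ} {f : Fin m → (Fin m → ℝ) → ℝ} (h : SatC12 m f) (j i : Fin m)
    (s : Fin m → ℝ) (hs : ∀ l, 0 < s l) :
    ContinuousAt (fun t => f j (Function.update s i t)) (s i) :=
  ((h.1 j i s (fun l => (hs l).le)).continuousOn).continuousAt (Ici_mem_nhds (hs i))

lemma f_upper {m : ℕ} {f : Fin m → (Fin m → ℝ) → ℝ} (h : SatC12 m f) (j : Fin m)
    (x : Fin m → ℝ) (hx : ∀ l, 0 < x l) (S : Finset (Fin m)) :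
    ∀ e : ℝ, 0 < e → ∃ d : ℝ, 0 < d ∧
      f j (fun l => if l ∈ S then x l + d else x l) < f j x + e := by
  classical
  induction S using Finset.induction_on with
  | empty => intro e he; exact ⟨1, one_pos, by simpa using he⟩
  | insert i S hi ih =>
    intro e he
    obtain ⟨d, hd, hlt⟩ := ih (e/2) (by positivity)
    set y : Fin m → ℝ := fun l => if l ∈ S then x l + d else x l with hy
    have hypos : ∀ l, 0 < y l := by
      intro l; simp only [hy]; have := hx l; split_ifs <;> linarith
    have hc := upd_cont h j i y hypos
    have hyi : y i = x i := by simp [hy, hi]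
    have h1 : f j (Function.update y i (y i)) < f j x + e := by
      rw [Function.update_eq_self]; linarith
    have h2 := hc.eventually (gt_mem_nhds h1)
    obtain ⟨δ, hδ, hball⟩ := Metric.eventually_nhds_iff.1 h2
    refine ⟨min d (δ/2), by positivity, ?_⟩
    have h3 := @hball (y i + δ/2) (by simp [abs_of_pos hδ, hδ])
    refine lt_of_le_of_lt (h.2.2.2.2 j _ _ ?_ ?_) h3
    · intro l
      have := hx l
      have : 0 < min d (δ/2) := by positivity
      split_ifs <;> linarith
    · intro l
      have e1 := min_le_left d (δ/2)
      have e2 := min_le_right d (δ/2)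
      by_cases hl : l = i
      · subst hl; simp [hyi]
      · simp only [Function.update_of_ne hl, hy, Finset.mem_insert, hl, false_or]
        split_ifs <;> linarith

lemma f_lower {m : ℕ} {f : Fin m → (Fin m → ℝ) → ℝ} (h : SatC12 m f) (j : Fin m)
    (x : Fin m → ℝ) (hx : ∀ l, 0 < x l) (S : Finset (Fin m)) :
    ∀ e : ℝ, 0 < e → ∃ d : ℝ, 0 < d ∧ (∀ l, d < x l) ∧ 
      f j x - e < f j (fun l => if l ∈ S then x l - d else x l) := by
  classical
  induction S using Finset.induction_on with
  | empty =>
    intro e he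
    have : ∀ᶠ d in nhdsWithin (0:ℝ) (Ioi 0), ∀ l, d < x l := by
      rw [Filter.eventually_all]
      intro l
      exact nhdsWithin_le_nhds (gt_mem_nhds (hx l))
    obtain ⟨d, h1, h2⟩ := (this.and self_mem_nhdsWithin).exists
    exact ⟨d, h2, h1, by simpa using he⟩
  | insert i S hi ih =>
    intro e he
    obtain ⟨d, hd, hdx, hlt⟩ := ih (e/2) (by positivity)
    set y : Fin m → ℝ := fun l => if l ∈ S then x l - d else x l with hy
    have hypos : ∀ l, 0 < y l := by
      intro l; simp only [hy]; have := hx l; have := hdx l; split_ifs <;> linarith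
    have hc := upd_cont h j i y hypos
    have hyi : y i = x i := by simp [hy, hi]
    have h1 : f j x - e < f j (Function.update y i (y i)) := by
      rw [Function.update_eq_self]; linarith
    have h2 := hc.eventually (lt_mem_nhds h1)
    obtain ⟨δ, hδ, hball⟩ := Metric.eventually_nhds_iff.1 h2
    have hm0 : 0 < min d (δ/2) := by positivity
    have e1 := min_le_left d (δ/2)
    have e2 := min_le_right d (δ/2)
    refine ⟨min d (δ/2), hm0, fun l => lt_of_le_of_lt e1 (hdx l), ?_⟩
    have h3 := @hball (y i - min d (δ/2)) (by
      rw [Real.dist_eq, abs_lt]; constructor <;> linarith)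
    refine lt_of_lt_of_le h3 (h.2.2.2.2 j _ _ ?_ ?_)
    · intro l
      by_cases hl : l = i
      · subst hl; have := hdx l; simp only [Function.update_self]; linarith
      · simp only [Function.update_of_ne hl]; exact (hypos l).le
    · intro l
      by_cases hl : l = i
      · subst hl; simp [hyi]
      · simp only [Function.update_of_ne hl, hy, Finset.mem_insert, hl, false_or]
        split_ifs <;> linarith

lemma f_cont_s8 {m : ℕ} {f : Fin m → (Fin m → ℝ) → ℝ} (h : SatC12 m f) (j : Fin m)
    (x : Fin m → ℝ) (hx : ∀ l, 0 < x l) : ContinuousAt (f j) x := by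
  rw [Metric.continuousAt_iff]
  intro e he
  obtain ⟨d1, hd1, h1⟩ := f_upper h j x hx Finset.univ e he
  obtain ⟨d2, hd2, hdx, h2⟩ := f_lower h j x hx Finset.univ e he
  simp only [Finset.mem_univ, if_true] at h1 h2
  refine ⟨min d1 d2, by positivity, fun {y} hy => ?_⟩
  have hyl : ∀ l, |y l - x l| < min d1 d2 := fun l =>
    lt_of_le_of_lt (by simpa [Real.dist_eq] using dist_le_pi_dist y x l) hy
  have e1 := min_le_left d1 d2
  have e2 := min_le_right d1 d2
  have a1 : f j y ≤ f j (fun l => x l + d1) := h.2.2.2.2 j _ _ (fun l => by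
    have := (abs_lt.1 (hyl l)).1; have := hdx l; linarith) (fun l => by
    have := (abs_lt.1 (hyl l)).2; linarith)
  have a2 : f j (fun l => x l - d2) ≤ f j y := h.2.2.2.2 j _ _ (fun l => by
    have := hdx l; linarith) (fun l => by
    have := (abs_lt.1 (hyl l)).1; linarith)
  rw [Real.dist_eq, abs_lt]; constructor <;> linarith

lemma diag_contAt {m : ℕ} {f : Fin m → (Fin m → ℝ) → ℝ} (h : SatC12 m f) {x : ℝ} (hx : 0 < x) :
    ContinuousAt (fun t => ∑ i, f i (fun _ => t)) x := by
  refine tendsto_finsetSum _ fun i _ => ?_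
  have h1 := f_cont_s8 h i (fun _ => x) (fun _ => hx)
  exact ContinuousAt.comp (f := fun t : ℝ => (fun _ : Fin m => t)) h1
    (by fun_prop)

lemma diag_int {m : ℕ} {f : Fin m → (Fin m → ℝ) → ℝ} (h : SatC12 m f) {x : ℝ} (hx : 0 ≤ x) :
    IntervalIntegrable (fun t => ∑ i, f i (fun _ => t)) volume 0 x := by
  apply MonotoneOn.intervalIntegrable
  rw [uIcc_of_le hx]
  intro s hs t ht hst
  exact Finset.sum_le_sum fun i _ => h.2.2.2.2 i _ _ (fun _ => hs.1) (fun _ => hst)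

lemma F_deriv {m : ℕ} {f : Fin m → (Fin m → ℝ) → ℝ} (h : SatC12 m f) {x : ℝ} (hx : 0 < x) :
    HasDerivAt (Fsum m f) (∑ i, f i (fun _ => x)) x := by
  refine integral_hasDerivAt_right (diag_int h hx.le) ?_ (diag_contAt h hx)
  exact ContinuousOn.stronglyMeasurableAtFilter isOpen_Ioi
    (fun y hy => (diag_contAt h hy).continuousWithinAt) x hx

lemma F_pos {m : ℕ} (hm : 1 ≤ m) {f : Fin m → (Fin m → ℝ) → ℝ} (h : SatC12 m f) {x : ℝ}
    (hx : 0 < x) : 0 < Fsum m f x := by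
  refine intervalIntegral_pos_of_pos_on (diag_int h hx.le) (fun t ht => ?_) hx
  have : Nonempty (Fin m) := ⟨⟨0, hm⟩⟩
  exact Finset.sum_pos (fun i _ => h.2.2.2.1 i _ fun _ => ht.1) Finset.univ_nonempty

lemma F_mono {m : ℕ} {f : Fin m → (Fin m → ℝ) → ℝ} (h : SatC12 m f) {x y : ℝ}
    (hx : 0 < x) (hxy : x ≤ y) : Fsum m f x ≤ Fsum m f y := by
  have := intervalIntegral.integral_add_adjacent_intervals (diag_int h hx.le)
    ((diag_int h hx.le).symm.trans (diag_int h (hx.le.trans hxy)))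
  have h2 : 0 ≤ ∫ t in x..y, ∑ i, f i (fun _ => t) := integral_nonneg hxy fun t ht =>
    Finset.sum_nonneg fun i _ => h.2.1 i _ fun _ => hx.le.trans ht.1
  unfold Fsum
  linarith

/-- The inner integral. -/
noncomputable def GG (m N : ℕ) (b : Fin m → ℝ → ℝ)
    (f : Fin m → (Fin m → ℝ) → ℝ) (w : Fin m → ℝ → ℝ) (i : Fin m) (r : ℝ) : ℝ :=
  ∫ s in (0:ℝ)..r, s ^ ((N:ℝ) - 1) * b i s * f i (fun j => w j s)

section sol
variable {m N : ℕ} {p : ℝ} {f : Fin m → (Fin m → ℝ) → ℝ} {b : Fin m → ℝ → ℝ}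
  {β : ℝ} {w : Fin m → ℝ → ℝ}

lemma G_nonneg (hf : SatC12 m f) (hbnn : ∀ j r, 0 ≤ r → 0 ≤ b j r)
    (hw : IsRadialSolution m N p b f β w) (i : Fin m) {r : ℝ} (hr : 0 ≤ r) :
    0 ≤ GG m N b f w i r :=
  integral_nonneg hr fun t ht => mul_nonneg (mul_nonneg (rpow_nonneg ht.1 _) (hbnn i t ht.1))
    (hf.2.1 i _ fun l => hw.2.1 l t ht.1)

lemma wd_nonneg (hf : SatC12 m f) (hbnn : ∀ j r, 0 ≤ r → 0 ≤ b j r)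
    (hw : IsRadialSolution m N p b f β w) (i : Fin m) {r : ℝ} (hr : 0 ≤ r) :
    0 ≤ wderiv m N p b f w i r :=
  rpow_nonneg (mul_nonneg (rpow_nonneg hr _) (G_nonneg hf hbnn hw i hr)) _

lemma w_ge (hf : SatC12 m f) (hbnn : ∀ j r, 0 ≤ r → 0 ≤ b j r)
    (hw : IsRadialSolution m N p b f β w) (i : Fin m) {r : ℝ} (hr : 0 ≤ r) :
    β ≤ w i r := by
  rw [hw.2.2 i r hr]
  have : 0 ≤ ∫ t in (0:ℝ)..r, wderiv m N p b f w i t :=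
    integral_nonneg hr fun t ht => wd_nonneg hf hbnn hw i ht.1
  unfold wderiv at this
  linarith

lemma integrand_cont (hN : 2 ≤ N) (hf : SatC12 m f) (hbc : ∀ j, ContinuousOn (b j) (Set.Ici 0))
    (hbnn : ∀ j r, 0 ≤ r → 0 ≤ b j r) (hβ : 0 < β)
    (hw : IsRadialSolution m N p b f β w) (i : Fin m) :
    ContinuousOn (fun s => s ^ ((N:ℝ) - 1) * b i s * f i (fun j => w j s)) (Ici 0) := by
  have hN' : (2:ℝ) ≤ N := by exact_mod_cast hN
  refine ContinuousOn.mul (ContinuousOn.mul ?_ (hbc i)) ?_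
  · exact (Real.continuous_rpow_const (by linarith)).continuousOn
  · intro s hs
    refine ContinuousAt.comp_continuousWithinAt (g := f i) (f := fun s => (fun j => w j s))
      (f_cont_s8 hf i _ fun l => lt_of_lt_of_le hβ (w_ge hf hbnn hw l hs)) ?_
    exact continuousWithinAt_pi.2 fun l => hw.1 l s hs

lemma G_deriv (hN : 2 ≤ N) (hf : SatC12 m f) (hbc : ∀ j, ContinuousOn (b j) (Set.Ici 0))
    (hbnn : ∀ j r, 0 ≤ r → 0 ≤ b j r) (hβ : 0 < β)
    (hw : IsRadialSolution m N p b f β w) (i : Fin m) {r : ℝ} (hr : 0 < r) :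
    HasDerivAt (GG m N b f w i) (r ^ ((N:ℝ) - 1) * b i r * f i (fun j => w j r)) r := by
  have hc := integrand_cont hN hf hbc hbnn hβ hw i
  refine integral_hasDerivAt_right ?_ ?_ (hc.continuousAt (Ici_mem_nhds hr))
  · apply ContinuousOn.intervalIntegrable
    exact hc.mono (by rw [uIcc_of_le hr.le]; exact Icc_subset_Ici_self)
  · exact ContinuousOn.stronglyMeasurableAtFilter isOpen_Ioi
      (hc.mono Ioi_subset_Ici_self) r hr

lemma wd_cont (hN : 2 ≤ N) (hp1 : 1 < p) (hf : SatC12 m f)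
    (hbc : ∀ j, ContinuousOn (b j) (Set.Ici 0))
    (hbnn : ∀ j r, 0 ≤ r → 0 ≤ b j r) (hβ : 0 < β)
    (hw : IsRadialSolution m N p b f β w) (i : Fin m) :
    ContinuousOn (wderiv m N p b f w i) (Ioi 0) := by
  intro r hr
  have h1 : ContinuousAt (fun r => r ^ (1 - (N:ℝ)) * GG m N b f w i r) r :=
    ContinuousAt.mul (continuousAt_rpow_const _ _ (Or.inl (ne_of_gt hr)))
      (G_deriv hN hf hbc hbnn hβ hw i hr).continuousAt
  have : 0 < 1 / (p-1) := by have : 0 < p - 1 := by linarith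
                             positivity
  exact (h1.rpow_const (Or.inr this.le)).continuousWithinAt

lemma wd_int (hN : 2 ≤ N) (hp1 : 1 < p) (hf : SatC12 m f)
    (hbc : ∀ j, ContinuousOn (b j) (Set.Ici 0))
    (hbnn : ∀ j r, 0 ≤ r → 0 ≤ b j r) (hβ : 0 < β)
    (hw : IsRadialSolution m N p b f β w) (i : Fin m) {r : ℝ} (hr : 0 < r) :
    IntervalIntegrable (wderiv m N p b f w i) volume 0 r := by
  have hN' : (2:ℝ) ≤ N := by exact_mod_cast hN
  have hp : 0 < 1 / (p-1) := by have : 0 < p - 1 := by linarith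
                                positivity
  have hc : ContinuousOn (fun s => b i s * f i (fun j => w j s)) (Icc 0 r) := by
    refine ContinuousOn.mul ((hbc i).mono Icc_subset_Ici_self) ?_
    intro s hs
    refine ContinuousAt.comp_continuousWithinAt (g := f i) (f := fun s => (fun j => w j s))
      (f_cont_s8 hf i _ fun l => lt_of_lt_of_le hβ (w_ge hf hbnn hw l hs.1)) ?_
    exact continuousWithinAt_pi.2 fun l => (hw.1 l s hs.1).mono Icc_subset_Ici_self
  obtain ⟨M, hM⟩ := isCompact_Icc.exists_bound_of_continuousOn hc
  have hM0 : 0 ≤ M := (norm_nonneg _).trans (hM 0 ⟨le_rfl, hr.le⟩)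
  have hGb : ∀ t ∈ Ioc 0 r, t ^ (1 - (N:ℝ)) * GG m N b f w i t ≤ M * r := by
    intro t ht
    have h1 : GG m N b f w i t ≤ (t ^ ((N:ℝ)-1) * M) * t := by
      have := intervalIntegral.norm_integral_le_of_norm_le_const (a := 0) (b := t)
        (f := fun s => s ^ ((N:ℝ) - 1) * b i s * f i (fun j => w j s))
        (C := t ^ ((N:ℝ)-1) * M) (by
          intro s hs
          rw [uIoc_of_le ht.1.le] at hs
          rw [mul_assoc, norm_mul]
          refine mul_le_mul ?_ (hM s ⟨hs.1.le, hs.2.trans ht.2⟩) (norm_nonneg _)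
            (rpow_nonneg ht.1.le _)
          rw [Real.norm_of_nonneg (rpow_nonneg hs.1.le _)]
          exact rpow_le_rpow hs.1.le hs.2 (by linarith))
      rw [sub_zero, abs_of_pos ht.1] at this
      exact (le_abs_self _).trans this
    calc t ^ (1 - (N:ℝ)) * GG m N b f w i t ≤ t ^ (1 - (N:ℝ)) * ((t ^ ((N:ℝ)-1) * M) * t) :=
          mul_le_mul_of_nonneg_left h1 (rpow_nonneg ht.1.le _)
      _ = (t ^ (1 - (N:ℝ)) * t ^ ((N:ℝ)-1)) * (M * t) := by ring
      _ = M * t := by rw [← rpow_add ht.1]; simp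
      _ ≤ M * r := mul_le_mul_of_nonneg_left ht.2 hM0
  rw [intervalIntegrable_iff_integrableOn_Ioc_of_le hr.le]
  refine IntegrableOn.of_bound (by simp) ?_ ((M * r) ^ (1/(p-1))) ?_
  · exact (((wd_cont hN hp1 hf hbc hbnn hβ hw i).mono Ioc_subset_Ioi_self).aestronglyMeasurable
      measurableSet_Ioc)
  · refine (ae_restrict_iff' measurableSet_Ioc).2 (Eventually.of_forall fun t ht => ?_)
    rw [Real.norm_of_nonneg (wd_nonneg hf hbnn hw i ht.1.le)]
    exact rpow_le_rpow (mul_nonneg (rpow_nonneg ht.1.le _) (G_nonneg hf hbnn hw i ht.1.le))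
      (hGb t ht) hp.le

lemma w_deriv (hN : 2 ≤ N) (hp1 : 1 < p) (hf : SatC12 m f)
    (hbc : ∀ j, ContinuousOn (b j) (Set.Ici 0))
    (hbnn : ∀ j r, 0 ≤ r → 0 ≤ b j r) (hβ : 0 < β)
    (hw : IsRadialSolution m N p b f β w) (i : Fin m) {r : ℝ} (hr : 0 < r) :
    HasDerivAt (w i) (wderiv m N p b f w i r) r := by
  have hc := wd_cont hN hp1 hf hbc hbnn hβ hw i
  have h1 : HasDerivAt (fun r => β + ∫ t in (0:ℝ)..r, wderiv m N p b f w i t)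
      (wderiv m N p b f w i r) r := by
    refine HasDerivAt.const_add _ (integral_hasDerivAt_right
      (wd_int hN hp1 hf hbc hbnn hβ hw i hr)
      (hc.stronglyMeasurableAtFilter isOpen_Ioi r hr) (hc.continuousAt (Ioi_mem_nhds hr)))
  refine h1.congr_of_eventuallyEq ?_
  filter_upwards [Ioi_mem_nhds hr] with s hs
  rw [hw.2.2 i s (le_of_lt hs)]
  rfl

lemma wd_pow (hf : SatC12 m f) (hbnn : ∀ j r, 0 ≤ r → 0 ≤ b j r)
    (hw : IsRadialSolution m N p b f β w) (i : Fin m) {r : ℝ} (hr : 0 < r) :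
    r ^ (p*((N:ℝ)-1)/(p-1)) * (wderiv m N p b f w i r) ^ p = GG m N b f w i r ^ (p/(p-1)) := by
  have hG := G_nonneg hf hbnn hw i hr.le
  have e : wderiv m N p b f w i r = (r ^ (1 - (N:ℝ)) * GG m N b f w i r) ^ (1/(p-1)) := rfl
  rw [e, ← rpow_mul (mul_nonneg (rpow_nonneg hr.le _) hG), mul_rpow (rpow_nonneg hr.le _) hG,
    ← rpow_mul hr.le, ← mul_assoc, ← rpow_add hr]
  have : p*((N:ℝ)-1)/(p-1) + (1 - (N:ℝ)) * (1/(p-1)*p) = 0 := by ring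
  rw [this, rpow_zero, one_mul]
  congr 1; ring

lemma wd_pow1 (hf : SatC12 m f) (hbnn : ∀ j r, 0 ≤ r → 0 ≤ b j r)
    (hw : IsRadialSolution m N p b f β w) (i : Fin m) {r : ℝ} (hr : 0 < r) :
    r ^ (((N:ℝ)-1)/(p-1)) * (wderiv m N p b f w i r) = GG m N b f w i r ^ (1/(p-1)) := by
  have hG := G_nonneg hf hbnn hw i hr.le
  have e : wderiv m N p b f w i r = (r ^ (1 - (N:ℝ)) * GG m N b f w i r) ^ (1/(p-1)) := rfl
  rw [e, mul_rpow (rpow_nonneg hr.le _) hG,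
    ← rpow_mul hr.le, ← mul_assoc, ← rpow_add hr]
  have : ((N:ℝ)-1)/(p-1) + (1 - (N:ℝ)) * (1/(p-1)) = 0 := by ring
  rw [this, rpow_zero, one_mul]

lemma Phi_deriv (hN : 2 ≤ N) (hp1 : 1 < p) (hf : SatC12 m f)
    (hbc : ∀ j, ContinuousOn (b j) (Set.Ici 0))
    (hbnn : ∀ j r, 0 ≤ r → 0 ≤ b j r) (hβ : 0 < β)
    (hw : IsRadialSolution m N p b f β w) (i : Fin m) {r : ℝ} (hr : 0 < r) :
    HasDerivAt (fun s => GG m N b f w i s ^ (p/(p-1)))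
      (p/(p-1) * (r ^ (p*((N:ℝ)-1)/(p-1)) * b i r * f i (fun j => w j r) *
        wderiv m N p b f w i r)) r := by
  have hp : 0 < p - 1 := by linarith
  have h1 : (1:ℝ) ≤ p/(p-1) := by rw [le_div_iff₀ hp]; linarith
  have := (G_deriv hN hf hbc hbnn hβ hw i hr).rpow_const (p := p/(p-1)) (Or.inr h1)
  convert this using 1
  have e1 : p/(p-1) - 1 = 1/(p-1) := by field_simp; ring
  have e2 : p*((N:ℝ)-1)/(p-1) = ((N:ℝ)-1)/(p-1) + ((N:ℝ)-1) := by field_simp; ring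
  rw [e1, ← wd_pow1 hf hbnn hw i hr, e2, rpow_add hr]
  ring

end sol

/-- The integrated estimate (4.1)/(3.12): for `r ≥ R`,
`∫_{Σw(R)}^{Σw(r)} F(t)^(-1/p) dt ≤ C^(1/p) F(Σw(R))^(-1/p) ((p-1)/(N-p)) R^((p-N)/(p-1))
  + (1/2)^(1/p) (p m^(p-1)/(p-1))^(1/p) [∫_R^r t^(1+ε)(Σ b_i(t))^(2/p) dt + 1/(ε R^ε)]`. -/
theorem stmt8 (m N : ℕ) (p : ℝ) (hm : 1 ≤ m) (hN : 2 ≤ N)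
    (hp1 : 1 < p) (hpN : p ≤ (N:ℝ) - 1)
    (f : Fin m → (Fin m → ℝ) → ℝ) (hf12 : SatC12 m f)
    (b : Fin m → ℝ → ℝ) (hbc : ∀ j, ContinuousOn (b j) (Set.Ici 0))
    (hbnn : ∀ j r, 0 ≤ r → 0 ≤ b j r)
    (β : ℝ) (hβ : 0 < β)
    (w : Fin m → ℝ → ℝ) (hw : IsRadialSolution m N p b f β w)
    (R : ℝ) (hR : 0 < R)
    (hmono : ∀ r s, R ≤ r → r ≤ s →
      r ^ (p*((N:ℝ)-1)/(p-1)) * ∑ i, b i r ≤ s ^ (p*((N:ℝ)-1)/(p-1)) * ∑ i, b i s)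
    (ε : ℝ) (hε : 0 < ε) :
    ∀ r, R ≤ r →
      ∫ t in (∑ i, w i R)..(∑ i, w i r), (Fsum m f t) ^ (-1/p) ≤
        ((m:ℝ) ^ (p-1) * R ^ (p*((N:ℝ)-1)/(p-1)) * ∑ i, (wderiv m N p b f w i R) ^ p) ^ (1/p)
            * (Fsum m f (∑ i, w i R)) ^ (-1/p) * ((p-1)/((N:ℝ)-p)) * R ^ ((p-(N:ℝ))/(p-1))
          + (1/2 : ℝ) ^ (1/p) * (p * (m:ℝ) ^ (p-1) / (p-1)) ^ (1/p) *
            ((∫ t in R..r, t ^ (1+ε) * (∑ i, b i t) ^ (2/p)) + 1/(ε * R ^ ε)) := by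
  intro r hr
  have hp0 : 0 < p := by linarith
  have hpm : 0 < p - 1 := by linarith
  have hNp : 0 < (N:ℝ) - p := by linarith
  have hip : 0 < 1/p := by positivity
  have hne : Nonempty (Fin m) := ⟨⟨0, hm⟩⟩
  have hm0 : (0:ℝ) < m := by exact_mod_cast hm
  set W : ℝ → ℝ := fun s => ∑ i, w i s with hWdef
  set W' : ℝ → ℝ := fun s => ∑ i, wderiv m N p b f w i s with hW'def
  set B : ℝ → ℝ := fun s => ∑ i, b i s with hBdef
  set q : ℝ := p*((N:ℝ)-1)/(p-1) with hq
  set C : ℝ := (m:ℝ) ^ (p-1) * R ^ q * ∑ i, (wderiv m N p b f w i R) ^ p with hC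
  set K : ℝ := p * (m:ℝ) ^ (p-1) / (p-1) with hK
  have hpos : ∀ {s}, R ≤ s → 0 < s := fun h => hR.trans_le h
  have hWpos : ∀ {s}, R ≤ s → 0 < W s := fun h =>
    Finset.sum_pos (fun i _ => hβ.trans_le (w_ge hf12 hbnn hw i (hpos h).le)) Finset.univ_nonempty
  have hWd : ∀ {s}, R ≤ s → HasDerivAt W (W' s) s := fun h =>
    HasDerivAt.fun_sum fun i _ => w_deriv hN hp1 hf12 hbc hbnn hβ hw i (hpos h)
  have hwd0 : ∀ i {s}, R ≤ s → 0 ≤ wderiv m N p b f w i s := fun i s h =>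
    wd_nonneg hf12 hbnn hw i (hpos h).le
  have hW'0 : ∀ {s}, R ≤ s → 0 ≤ W' s := fun h => Finset.sum_nonneg fun i _ => hwd0 i h
  have hB0 : ∀ {s}, R ≤ s → 0 ≤ B s := fun h => Finset.sum_nonneg fun i _ => hbnn i _ (hpos h).le
  have hFpos : ∀ {s}, R ≤ s → 0 < Fsum m f (W s) := fun h => F_pos hm hf12 (hWpos h)
  have hWmono : ∀ {s}, R ≤ s → W R ≤ W s := by
    intro s hs
    have : MonotoneOn W (Ici R) := by
      refine monotoneOn_of_deriv_nonneg (convex_Ici R)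
        (fun x hx => (hWd hx).continuousAt.continuousWithinAt) ?_ ?_
      · intro x hx
        rw [interior_Ici] at hx
        exact (hWd (le_of_lt hx)).differentiableAt.differentiableWithinAt
      · intro x hx
        rw [interior_Ici] at hx
        rw [(hWd (le_of_lt hx)).deriv]
        exact hW'0 (le_of_lt hx)
    exact this (mem_Ici.2 le_rfl) (mem_Ici.2 hs) hs
  have hC0 : 0 ≤ C := mul_nonneg (by positivity)
    (Finset.sum_nonneg fun i _ => rpow_nonneg (hwd0 i le_rfl) _)
  have hK0 : 0 ≤ K := by positivity
  -- energy estimate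
  have energy : ∀ s, R ≤ s → ∑ i, GG m N b f w i s ^ (p/(p-1)) ≤
      ∑ i, GG m N b f w i R ^ (p/(p-1)) + p/(p-1) * (s ^ q * B s) * Fsum m f (W s) := by
    intro s hs
    set A := s ^ q * B s with hA
    have hA0 : 0 ≤ A := mul_nonneg (rpow_nonneg (hpos hs).le _) (hB0 hs)
    have hd : ∀ x, R ≤ x → HasDerivAt
        (fun x => p/(p-1) * A * Fsum m f (W x) - ∑ i, GG m N b f w i x ^ (p/(p-1)))
        (p/(p-1) * A * ((∑ i, f i (fun _ => W x)) * W' x) - ∑ i, (p/(p-1) * (x ^ q * b i x *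
          f i (fun j => w j x) * wderiv m N p b f w i x))) x := by
      intro x hx
      refine HasDerivAt.sub (HasDerivAt.const_mul _ ?_) (HasDerivAt.fun_sum fun i _ => ?_)
      · exact HasDerivAt.comp x (F_deriv hf12 (hWpos hx)) (hWd hx)
      · exact Phi_deriv hN hp1 hf12 hbc hbnn hβ hw i (hpos hx)
    have hmon : MonotoneOn
        (fun x => p/(p-1) * A * Fsum m f (W x) - ∑ i, GG m N b f w i x ^ (p/(p-1)))
        (Icc R s) := by
      refine monotoneOn_of_deriv_nonneg (convex_Icc R s)
        (fun x hx => (hd x hx.1).continuousAt.continuousWithinAt) ?_ ?_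
      · intro x hx
        rw [interior_Icc] at hx
        exact (hd x hx.1.le).differentiableAt.differentiableWithinAt
      · intro x hx
        rw [interior_Icc] at hx
        rw [(hd x hx.1.le).deriv, ← Finset.mul_sum, mul_assoc (p/(p-1)), ← mul_sub]
        refine mul_nonneg (by positivity) (sub_nonneg.2 ?_)
        have hx1 := hx.1.le
        have hf0 : ∀ i, 0 ≤ f i (fun _ => W x) := fun i => hf12.2.1 i _ fun _ => (hWpos hx1).le
        have hxA : x ^ q * B x ≤ A := hmono x s hx1 hx.2.le
        calc ∑ i, x ^ q * b i x * f i (fun j => w j x) * wderiv m N p b f w i x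
            ≤ ∑ i, A * (f i (fun _ => W x) * W' x) := by
              refine Finset.sum_le_sum fun i _ => ?_
              have h1 : x ^ q * b i x ≤ A := by
                refine le_trans (mul_le_mul_of_nonneg_left ?_ (rpow_nonneg (hpos hx1).le _)) hxA
                exact Finset.single_le_sum (f := fun i => b i x)
                  (fun j _ => hbnn j x (hpos hx1).le) (Finset.mem_univ i)
              have h2 : f i (fun j => w j x) ≤ f i (fun _ => W x) :=
                hf12.2.2.2.2 i _ _ (fun l => hw.2.1 l x (hpos hx1).le) fun l =>
                  Finset.single_le_sum (f := fun i => w i x)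
                    (fun j _ => hw.2.1 j x (hpos hx1).le) (Finset.mem_univ l)
              have h3 : wderiv m N p b f w i x ≤ W' x :=
                Finset.single_le_sum (f := fun i => wderiv m N p b f w i x)
                    (fun j _ => hwd0 j hx1) (Finset.mem_univ i)
              rw [← mul_assoc]
              refine mul_le_mul (mul_le_mul h1 h2 (hf12.2.1 i _ fun l => hw.2.1 l x (hpos hx1).le)
                hA0) h3 (hwd0 i hx1) (mul_nonneg hA0 (hf0 i))
          _ = A * ((∑ i, f i (fun _ => W x)) * W' x) := by
              rw [← Finset.mul_sum, ← Finset.sum_mul]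
    have h1 := hmon (left_mem_Icc.2 hs) (right_mem_Icc.2 hs) hs
    simp only at h1
    have h2 : 0 ≤ p/(p-1) * A * Fsum m f (W R) :=
      mul_nonneg (mul_nonneg (by positivity) hA0) (hFpos le_rfl).le
    linarith
  -- pointwise derivative estimate
  have hW'le : ∀ s, R ≤ s → W' s ≤ C ^ (1/p) * s ^ (-(((N:ℝ)-1)/(p-1))) +
      K ^ (1/p) * (B s ^ (1/p) * Fsum m f (W s) ^ (1/p)) := by
    intro s hs
    have hs0 := hpos hs
    have h1 : W' s ^ p ≤ (m:ℝ) ^ (p-1) * ∑ i, wderiv m N p b f w i s ^ p := by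
      have := Real.rpow_sum_le_const_mul_sum_rpow_of_nonneg (s := Finset.univ)
        (f := fun i => wderiv m N p b f w i s) hp1.le (fun i _ => hwd0 i hs)
      simpa using this
    have h2 : s ^ q * W' s ^ p ≤ C + K * (s ^ q * B s) * Fsum m f (W s) := by
      have e1 : ∀ x, R ≤ x → ∑ i, GG m N b f w i x ^ (p/(p-1))
          = x ^ q * ∑ i, wderiv m N p b f w i x ^ p := by
        intro x hx
        rw [Finset.mul_sum]
        exact Finset.sum_congr rfl fun i _ => (wd_pow hf12 hbnn hw i (hpos hx)).symm
      have h3 := energy s hs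
      rw [e1 s hs, e1 R le_rfl] at h3
      calc s ^ q * W' s ^ p
          ≤ s ^ q * ((m:ℝ) ^ (p-1) * ∑ i, wderiv m N p b f w i s ^ p) :=
            mul_le_mul_of_nonneg_left h1 (rpow_nonneg hs0.le _)
        _ = (m:ℝ) ^ (p-1) * (s ^ q * ∑ i, wderiv m N p b f w i s ^ p) := by ring
        _ ≤ _ := mul_le_mul_of_nonneg_left h3 (by positivity)
        _ = C + K * (s ^ q * B s) * Fsum m f (W s) := by rw [hC, hK]; ring
    have h4 : W' s ^ p ≤ C * s ^ (-q) + K * (B s * Fsum m f (W s)) := by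
      have e : s ^ (-q) * s ^ q = 1 := by rw [← rpow_add hs0]; simp
      calc W' s ^ p = s ^ (-q) * (s ^ q * W' s ^ p) := by rw [← mul_assoc, e, one_mul]
        _ ≤ s ^ (-q) * (C + K * (s ^ q * B s) * Fsum m f (W s)) :=
          mul_le_mul_of_nonneg_left h2 (rpow_nonneg hs0.le _)
        _ = C * s ^ (-q) + (s ^ (-q) * s ^ q) * (K * (B s * Fsum m f (W s))) := by ring
        _ = _ := by rw [e, one_mul]
    have hBF : 0 ≤ B s * Fsum m f (W s) := mul_nonneg (hB0 hs) (hFpos hs).le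
    have a0 : 0 ≤ C * s ^ (-q) := mul_nonneg hC0 (rpow_nonneg hs0.le _)
    have b0 : 0 ≤ K * (B s * Fsum m f (W s)) := mul_nonneg hK0 hBF
    calc W' s = (W' s ^ p) ^ (1/p) := by
          rw [← rpow_mul (hW'0 hs), mul_one_div_cancel hp0.ne', rpow_one]
      _ ≤ (C * s ^ (-q) + K * (B s * Fsum m f (W s))) ^ (1/p) :=
          rpow_le_rpow (rpow_nonneg (hW'0 hs) _) h4 hip.le
      _ ≤ (C * s ^ (-q)) ^ (1/p) + (K * (B s * Fsum m f (W s))) ^ (1/p) :=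
          Real.rpow_add_le_add_rpow a0 b0 hip.le (by rw [div_le_one hp0]; exact hp1.le)
      _ = _ := by
          rw [mul_rpow hC0 (rpow_nonneg hs0.le _), mul_rpow hK0 hBF, mul_rpow (hB0 hs) (hFpos hs).le,
            ← rpow_mul hs0.le]
          congr 3
          rw [hq]; field_simp
  -- integrand estimate
  have hpt : ∀ s, R ≤ s → Fsum m f (W s) ^ (-1/p) * W' s ≤
      C ^ (1/p) * Fsum m f (W R) ^ (-1/p) * s ^ (-(((N:ℝ)-1)/(p-1))) +
      (1/2) ^ (1/p) * K ^ (1/p) * (s ^ (1+ε) * B s ^ (2/p) + s ^ (-(1+ε))) := by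
    intro s hs
    have hs0 := hpos hs
    have hF := hFpos hs
    have e1 : Fsum m f (W s) ^ (-1/p) * Fsum m f (W s) ^ (1/p) = 1 := by
      rw [← rpow_add hF, ← add_div]; simp
    have h1 : Fsum m f (W s) ^ (-1/p) ≤ Fsum m f (W R) ^ (-1/p) :=
      rpow_le_rpow_of_nonpos (hFpos le_rfl) (F_mono hf12 (hWpos le_rfl) (hWmono hs))
        (by rw [neg_div]; linarith)
    have hs1 : 0 ≤ s ^ (-(((N:ℝ)-1)/(p-1))) := rpow_nonneg hs0.le _
    have hCp : 0 ≤ C ^ (1/p) := rpow_nonneg hC0 _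
    have hKp : 0 ≤ K ^ (1/p) := rpow_nonneg hK0 _
    have hhalf : (1/2:ℝ) ≤ (1/2) ^ (1/p) := by
      have := rpow_le_rpow_of_exponent_ge (x := (1/2:ℝ)) (by norm_num) (by norm_num)
        (show 1/p ≤ 1 by rw [div_le_one hp0]; exact hp1.le)
      simpa using this
    have hT : 0 ≤ s ^ (1+ε) * B s ^ (2/p) + s ^ (-(1+ε)) :=
      add_nonneg (mul_nonneg (rpow_nonneg hs0.le _) (rpow_nonneg (hB0 hs) _)) (rpow_nonneg hs0.le _)
    have hamgm : B s ^ (1/p) ≤ 1/2 * (s ^ (1+ε) * B s ^ (2/p) + s ^ (-(1+ε))) := by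
      set u := s ^ ((1+ε)/2) with hu
      have hu0 : 0 < u := rpow_pos_of_pos hs0 _
      have eu : s ^ (1+ε) = u ^ 2 := by
        rw [hu, ← rpow_natCast, ← rpow_mul hs0.le]; congr 1; push_cast; ring
      have eu' : s ^ (-(1+ε)) = (u⁻¹) ^ 2 := by
        rw [rpow_neg hs0.le, eu, inv_pow]
      have eB : B s ^ (2/p) = (B s ^ (1/p)) ^ 2 := by
        rw [← rpow_natCast, ← rpow_mul (hB0 hs)]; congr 1; push_cast; ring
      rw [eu, eu', eB]
      have e2 : u * u⁻¹ = 1 := mul_inv_cancel₀ hu0.ne'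
      have := sq_nonneg (u * B s ^ (1/p) - u⁻¹)
      have e3 : (u * B s ^ (1/p) - u⁻¹) ^ 2 = u ^ 2 * (B s ^ (1/p)) ^ 2 + u⁻¹ ^ 2
        - 2 * (u * u⁻¹) * B s ^ (1/p) := by ring
      rw [e3, e2] at this
      linarith
    calc Fsum m f (W s) ^ (-1/p) * W' s
        ≤ Fsum m f (W s) ^ (-1/p) * (C ^ (1/p) * s ^ (-(((N:ℝ)-1)/(p-1))) +
            K ^ (1/p) * (B s ^ (1/p) * Fsum m f (W s) ^ (1/p))) :=
          mul_le_mul_of_nonneg_left (hW'le s hs) (rpow_nonneg hF.le _)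
      _ = C ^ (1/p) * Fsum m f (W s) ^ (-1/p) * s ^ (-(((N:ℝ)-1)/(p-1))) +
          K ^ (1/p) * B s ^ (1/p) * (Fsum m f (W s) ^ (-1/p) * Fsum m f (W s) ^ (1/p)) := by ring
      _ = C ^ (1/p) * Fsum m f (W s) ^ (-1/p) * s ^ (-(((N:ℝ)-1)/(p-1))) +
          K ^ (1/p) * B s ^ (1/p) := by rw [e1, mul_one]
      _ ≤ C ^ (1/p) * Fsum m f (W R) ^ (-1/p) * s ^ (-(((N:ℝ)-1)/(p-1))) +
          K ^ (1/p) * ((1/2) ^ (1/p) * (s ^ (1+ε) * B s ^ (2/p) + s ^ (-(1+ε)))) := by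
          refine add_le_add (mul_le_mul_of_nonneg_right (mul_le_mul_of_nonneg_left h1 hCp) hs1)
            (mul_le_mul_of_nonneg_left (hamgm.trans (mul_le_mul_of_nonneg_right hhalf hT)) hKp)
      _ = _ := by ring
  -- change of variables
  have huIcc : uIcc R r = Icc R r := uIcc_of_le hr
  have hWc : ContinuousOn W (Icc R r) := fun x hx => (hWd hx.1).continuousAt.continuousWithinAt
  have hW'c : ContinuousOn W' (Icc R r) :=
    continuousOn_finsetSum _ fun i _ => (wd_cont hN hp1 hf12 hbc hbnn hβ hw i).mono
      fun x hx => hpos hx.1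
  have hFc : ContinuousOn (fun t => Fsum m f t ^ (-1/p)) (Ioi 0) := fun x hx =>
    ((F_deriv hf12 hx).continuousAt.rpow_const (Or.inl (F_pos hm hf12 hx).ne')).continuousWithinAt
  have hcv : ∫ t in (W R)..(W r), Fsum m f t ^ (-1/p)
      = ∫ s in R..r, Fsum m f (W s) ^ (-1/p) * W' s := by
    symm
    refine integral_comp_mul_deriv' (f := W) (f' := W') (g := fun t => Fsum m f t ^ (-1/p)) ?_ ?_ ?_
    · rw [huIcc]; exact fun x hx => hWd hx.1
    · rw [huIcc]; exact hW'c
    · rw [huIcc]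
      refine hFc.mono ?_
      rintro _ ⟨x, hx, rfl⟩
      exact hWpos hx.1
  have hsub : Icc R r ⊆ Ioi 0 := fun x hx => hpos hx.1
  have hrpc : ∀ a : ℝ, ContinuousOn (fun s : ℝ => s ^ a) (Icc R r) := fun a x hx =>
    (continuousAt_rpow_const x a (Or.inl (hpos hx.1).ne')).continuousWithinAt
  have hBc : ContinuousOn (fun s => s ^ (1+ε) * B s ^ (2/p)) (Icc R r) := by
    refine (hrpc _).mul (ContinuousOn.rpow_const ?_ fun x _ => Or.inr (by positivity))
    exact continuousOn_finsetSum _ fun i _ => (hbc i).mono fun x hx => (hpos hx.1).le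
  have i1 : IntervalIntegrable (fun s : ℝ => s ^ (-(((N:ℝ)-1)/(p-1)))) volume R r :=
    ContinuousOn.intervalIntegrable (by rw [huIcc]; exact hrpc _)
  have i2 : IntervalIntegrable (fun s => s ^ (1+ε) * B s ^ (2/p)) volume R r :=
    ContinuousOn.intervalIntegrable (by rw [huIcc]; exact hBc)
  have i3 : IntervalIntegrable (fun s : ℝ => s ^ (-(1+ε))) volume R r :=
    ContinuousOn.intervalIntegrable (by rw [huIcc]; exact hrpc _)
  have i0 : IntervalIntegrable (fun s => Fsum m f (W s) ^ (-1/p) * W' s) volume R r := by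
    refine ContinuousOn.intervalIntegrable ?_
    rw [huIcc]
    exact (hFc.comp hWc fun x hx => hWpos hx.1).mul hW'c
  have h0 : (0:ℝ) ∉ uIcc R r := by rw [huIcc]; exact fun h => absurd h.1 (not_le.2 hR)
  have tail : ∀ a : ℝ, 0 < a → ∫ s in R..r, s ^ (-(1+a)) ≤ R ^ (-a) / a := by
    intro a ha
    rw [integral_rpow (Or.inr ⟨by linarith, h0⟩)]
    have e : -(1+a) + 1 = -a := by ring
    rw [e, div_neg, ← neg_div, neg_sub]
    exact div_le_div_of_nonneg_right (by linarith [rpow_nonneg (hpos hr).le (-a)]) ha.le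
  have t1 : ∫ s in R..r, s ^ (-(((N:ℝ)-1)/(p-1))) ≤ ((p-1)/((N:ℝ)-p)) * R ^ ((p-(N:ℝ))/(p-1)) := by
    have := tail (((N:ℝ)-p)/(p-1)) (by positivity)
    have e1 : 1 + ((N:ℝ)-p)/(p-1) = ((N:ℝ)-1)/(p-1) := by field_simp; ring
    have e2 : -(((N:ℝ)-p)/(p-1)) = (p-(N:ℝ))/(p-1) := by ring
    rw [e1, e2] at this
    refine this.trans (le_of_eq ?_)
    rw [div_div_eq_mul_div]; ring
  have t2 : ∫ s in R..r, s ^ (-(1+ε)) ≤ 1/(ε * R ^ ε) := by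
    refine (tail ε hε).trans (le_of_eq ?_)
    rw [rpow_neg hR.le]; field_simp
  rw [hcv]
  calc ∫ s in R..r, Fsum m f (W s) ^ (-1/p) * W' s
      ≤ ∫ s in R..r, (C ^ (1/p) * Fsum m f (W R) ^ (-1/p) * s ^ (-(((N:ℝ)-1)/(p-1))) +
      (1/2) ^ (1/p) * K ^ (1/p) * (s ^ (1+ε) * B s ^ (2/p) + s ^ (-(1+ε)))) :=
        integral_mono_on hr i0 ((i1.const_mul _).add ((i2.add i3).const_mul _))
          fun x hx => hpt x hx.1
    _ = C ^ (1/p) * Fsum m f (W R) ^ (-1/p) * (∫ s in R..r, s ^ (-(((N:ℝ)-1)/(p-1)))) +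
      (1/2) ^ (1/p) * K ^ (1/p) * ((∫ s in R..r, s ^ (1+ε) * B s ^ (2/p)) +
        ∫ s in R..r, s ^ (-(1+ε))) := by
        rw [intervalIntegral.integral_add (i1.const_mul _) ((i2.add i3).const_mul _),
          intervalIntegral.integral_const_mul, intervalIntegral.integral_const_mul,
          intervalIntegral.integral_add i2 i3]
    _ ≤ C ^ (1/p) * Fsum m f (W R) ^ (-1/p) * (((p-1)/((N:ℝ)-p)) * R ^ ((p-(N:ℝ))/(p-1))) +
      (1/2) ^ (1/p) * K ^ (1/p) * ((∫ s in R..r, s ^ (1+ε) * B s ^ (2/p)) +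
        1/(ε * R ^ ε)) := by
        refine add_le_add (mul_le_mul_of_nonneg_left t1 (mul_nonneg (rpow_nonneg hC0 _)
          (rpow_nonneg (hFpos le_rfl).le _))) (mul_le_mul_of_nonneg_left (by linarith)
          (mul_nonneg (by positivity) (rpow_nonneg hK0 _)))
    _ = _ := by ring
end

section
/- Let m ≥ 1 be an integer and p > 1 a real number. If f_1,…,f_m satisfy (C1)–(C2) and ∫_1^∞ ( Σ_{i=1}^m f_i(s,…,s) )^{−1/(p−1)} ds = ∞, then ∫_1^∞ ( ∫_0^t Σ_{i=1}^m f_i(s,…,s) ds )^{−1/p} dt = ∞; that is, condition (C3) holds. -/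
open Real MeasureTheory Filter Set intervalIntegral

/-- Core estimate for a nondecreasing scalar function. -/
theorem core_div (p : ℝ) (hp1 : 1 < p) (g : ℝ → ℝ) (hmono : MonotoneOn g (Set.Ici 0))
    (hpos : ∀ s, 0 < s → 0 < g s)
    (hdiv : Tendsto (fun r => ∫ s in (1:ℝ)..r, (g s) ^ (-1/(p-1))) atTop atTop) :
    Tendsto (fun r => ∫ s in (1:ℝ)..r, (∫ t in (0:ℝ)..s, g t) ^ (-1/p)) atTop atTop := by
  have hp0 : 0 < p := by linarith
  have hq0 : 0 < p - 1 := by linarith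
  have gint : ∀ a b : ℝ, 0 ≤ a → a ≤ b → IntervalIntegrable g volume a b := by
    intro a b ha hab
    apply MonotoneOn.intervalIntegrable
    rw [Set.uIcc_of_le hab]
    exact hmono.mono (fun x hx => ha.trans hx.1)
  set F : ℝ → ℝ := fun s => ∫ t in (0:ℝ)..s, g t with hF
  have g0 : ∀ s, 0 < s → 0 ≤ g s := fun s hs => (hpos s hs).le
  have Fpos : ∀ s, 0 < s → 0 < F s := by
    intro s hs
    exact intervalIntegral.intervalIntegral_pos_of_pos_on (gint 0 s le_rfl hs.le)
      (fun x hx => hpos x hx.1) hs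
  have Fmono : ∀ a b, 1 ≤ a → a ≤ b → F a ≤ F b := by
    intro a b ha hab
    have h1 := intervalIntegral.integral_add_adjacent_intervals
      (gint 0 a le_rfl (by linarith)) (gint a b (by linarith) hab)
    have h2 : 0 ≤ ∫ t in a..b, g t :=
      intervalIntegral.integral_nonneg hab (fun u hu => g0 u (by linarith [hu.1]))
    simp only [hF]
    linarith
  have Fle : ∀ s, 1 ≤ s → F s ≤ s * g s := by
    intro s hs
    have h := intervalIntegral.integral_mono_on (a := 0) (b := s) (by linarith)
      (gint 0 s le_rfl (by linarith)) (intervalIntegrable_const (c := g s) (μ := volume))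
      (fun x hx => hmono (Set.mem_Ici.2 hx.1) (Set.mem_Ici.2 (by linarith)) hx.2)
    simpa using h
  set u : ℝ → ℝ := fun s => F s ^ (-1/p) with hu
  have upos : ∀ s, 1 ≤ s → 0 < u s := fun s hs => Real.rpow_pos_of_pos (Fpos s (by linarith)) _
  have uanti : ∀ a b, 1 ≤ a → a ≤ b → u b ≤ u a := by
    intro a b ha hab
    exact Real.rpow_le_rpow_of_nonpos (Fpos a (by linarith)) (Fmono a b ha hab)
      (div_nonpos_of_nonpos_of_nonneg (by norm_num) hp0.le)
  have uint : ∀ a b : ℝ, 1 ≤ a → a ≤ b → IntervalIntegrable u volume a b := by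
    intro a b ha hab
    apply AntitoneOn.intervalIntegrable
    rw [Set.uIcc_of_le hab]
    exact fun x hx y hy hxy => uanti x y (ha.trans hx.1) hxy
  have Gmono : ∀ a b, 1 ≤ a → a ≤ b → (∫ s in (1:ℝ)..a, u s) ≤ ∫ s in (1:ℝ)..b, u s := by
    intro a b ha hab
    have h1 := intervalIntegral.integral_add_adjacent_intervals
      (uint 1 a le_rfl ha) (uint a b ha hab)
    have h2 : 0 ≤ ∫ t in a..b, u t :=
      intervalIntegral.integral_nonneg hab (fun x hx => (upos x (by linarith [hx.1])).le)
    linarith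
  by_contra hnot
  have hbd : ∃ M, ∀ r, 1 ≤ r → (∫ s in (1:ℝ)..r, u s) ≤ M := by
    by_contra hcon
    push Not at hcon
    apply hnot
    rw [tendsto_atTop]
    intro M
    obtain ⟨r, hr, hrM⟩ := hcon M
    filter_upwards [eventually_ge_atTop r] with x hx
    exact hrM.le.trans (Gmono r x hr hx)
  obtain ⟨M, hM⟩ := hbd
  have hK : ∀ t, 1 ≤ t → u t * t ≤ M + u 1 := by
    intro t ht
    have h := intervalIntegral.integral_mono_on (a := 1) (b := t) ht
      (intervalIntegrable_const (c := u t) (μ := volume)) (uint 1 t le_rfl ht)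
      (fun x hx => uanti x t hx.1 hx.2)
    have h2 := hM t ht
    have h3 := uanti 1 t le_rfl ht
    simp only [intervalIntegral.integral_const, smul_eq_mul] at h
    nlinarith
  set C : ℝ := (M + u 1) ^ (1/(p-1)) with hC
  have key : ∀ t, 1 ≤ t → g t ^ (-1/(p-1)) ≤ C * u t := by
    intro t ht
    have t0 : 0 < t := by linarith
    have hFt := Fpos t t0
    have hut := upos t ht
    have e1 : F t / t ≤ g t := by
      rw [div_le_iff₀ t0]; linarith [Fle t ht]
    have e2 : g t ^ (-1/(p-1)) ≤ (F t / t) ^ (-1/(p-1)) :=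
      Real.rpow_le_rpow_of_nonpos (div_pos hFt t0) e1
        (div_nonpos_of_nonpos_of_nonneg (by norm_num) hq0.le)
    have e3 : (F t / t) ^ (-1/(p-1)) = (u t * t) ^ (1/(p-1)) * u t := by
      rw [Real.mul_rpow hut.le t0.le, Real.div_rpow hFt.le t0.le]
      simp only [hu]
      rw [← Real.rpow_mul hFt.le, mul_right_comm, ← Real.rpow_add hFt, div_eq_mul_inv,
        ← Real.rpow_neg t0.le]
      congr 2 <;> field_simp <;> ring
    have e4 : (u t * t) ^ (1/(p-1)) ≤ C :=
      Real.rpow_le_rpow (by positivity) (hK t ht) (by positivity)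
    rw [e3] at e2
    exact e2.trans (mul_le_mul_of_nonneg_right e4 hut.le)
  have hC0 : 0 ≤ C := by
    have := hK 1 le_rfl
    have := upos 1 le_rfl
    apply Real.rpow_nonneg
    linarith
  obtain ⟨r, hr1, hr2⟩ := ((tendsto_atTop.1 hdiv (C * M + 1)).and (eventually_ge_atTop 1)).exists
  have hgint : IntervalIntegrable (fun s => g s ^ (-1/(p-1))) volume 1 r := by
    apply AntitoneOn.intervalIntegrable
    rw [Set.uIcc_of_le hr2]
    intro x hx y hy hxy
    have hx0 : 0 < x := by linarith [hx.1]
    exact Real.rpow_le_rpow_of_nonpos (hpos x hx0)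
      (hmono (Set.mem_Ici.2 hx0.le) (Set.mem_Ici.2 (hx0.le.trans hxy)) hxy)
      (div_nonpos_of_nonpos_of_nonneg (by norm_num) hq0.le)
  have hfin := intervalIntegral.integral_mono_on hr2 hgint ((uint 1 r le_rfl hr2).const_mul C)
    (fun x hx => key x hx.1)
  rw [intervalIntegral.integral_const_mul] at hfin
  have := mul_le_mul_of_nonneg_left (hM r hr2) hC0
  linarith

/-- Remark 4.2: if (C1)–(C2) hold and `∫_1^∞ (Σ f_i(s,…,s))^(-1/(p-1)) ds = ∞`, then
condition (C3) holds. -/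
theorem stmt13 (m : ℕ) (p : ℝ) (hm : 1 ≤ m) (hp1 : 1 < p)
    (f : Fin m → (Fin m → ℝ) → ℝ) (hf12 : SatC12 m f)
    (hdiv : Tendsto (fun r => ∫ s in (1:ℝ)..r,
      (∑ i, f i (fun _ => s)) ^ (-1/(p-1))) atTop atTop) :
    SatC3 m p f := by
  obtain ⟨-, -, -, hpos, hmono⟩ := hf12
  haveI : Nonempty (Fin m) := ⟨⟨0, hm⟩⟩
  apply core_div p hp1 (fun t => ∑ i, f i (fun _ => t)) _ _ hdiv
  · intro a ha b _ hab
    exact Finset.sum_le_sum (fun i _ => hmono i _ _ (fun _ => ha) (fun _ => hab))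
  · intro s hs
    exact Finset.sum_pos (fun i _ => hpos i _ (fun _ => hs)) Finset.univ_nonempty
end
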